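/- arXiv:2505.05079 — 7 statements merged into one kernel-verified Lean document; each statement's English description precedes it below -/
import Mathlib

section
/- For every integer n ≥ 2, spt_2^d(n) = 2·p_d(n−1) − p_d(n). -/
/-!
Definitions following Andrews–El Bachraoui / Chen–Chen–Zhao:
partitions with repeated smallest part.
-/

/-- The smallest part of `π` occurs exactly `k` times and all remaining parts
occur exactly once (are distinct). -/
def IsSptD (k : ℕ) {n : ℕ} (π : n.Partition) : Prop :=
  ∃ s ∈ π.parts, (∀ x ∈ π.parts, s ≤ x) ∧ Multiset.count s π.parts = k ∧
    ∀ x ∈ π.parts, x ≠ s → Multiset.count x π.parts = 1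

/-- `spt k_d(n)`: the number of partitions of `n` whose smallest part occurs
exactly `k` times and whose remaining parts are distinct. -/
noncomputable def sptd (k n : ℕ) : ℕ :=
  Nat.card {π : n.Partition // IsSptD k π}

/-- The smallest part `s` of `π` occurs exactly `k` times, and all remaining parts
occur exactly once and are incongruent to `s` modulo 2. -/
def IsSptDO (k : ℕ) {n : ℕ} (π : n.Partition) : Prop :=
  ∃ s ∈ π.parts, (∀ x ∈ π.parts, s ≤ x) ∧ Multiset.count s π.parts = k ∧
    ∀ x ∈ π.parts, x ≠ s → Multiset.count x π.parts = 1 ∧ ¬ x % 2 = s % 2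

/-- `spt k_{do}(n)`. -/
noncomputable def sptdo (k n : ℕ) : ℕ :=
  Nat.card {π : n.Partition // IsSptDO k π}

/-- As `IsSptDO`, with in addition an even number of parts strictly greater
than the smallest part. -/
def IsSptDOEven (k : ℕ) {n : ℕ} (π : n.Partition) : Prop :=
  ∃ s ∈ π.parts, (∀ x ∈ π.parts, s ≤ x) ∧ Multiset.count s π.parts = k ∧
    (∀ x ∈ π.parts, x ≠ s → Multiset.count x π.parts = 1 ∧ ¬ x % 2 = s % 2) ∧
    Even (Multiset.card (π.parts.filter fun x => s < x))

/-- As `IsSptDO`, with in addition an odd number of parts strictly greater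
than the smallest part. -/
def IsSptDOOdd (k : ℕ) {n : ℕ} (π : n.Partition) : Prop :=
  ∃ s ∈ π.parts, (∀ x ∈ π.parts, s ≤ x) ∧ Multiset.count s π.parts = k ∧
    (∀ x ∈ π.parts, x ≠ s → Multiset.count x π.parts = 1 ∧ ¬ x % 2 = s % 2) ∧
    Odd (Multiset.card (π.parts.filter fun x => s < x))

/-- `B₀(k,n)`. -/
noncomputable def B0 (k n : ℕ) : ℕ :=
  Nat.card {π : n.Partition // IsSptDOEven k π}

/-- `B₁(k,n)`. -/
noncomputable def B1 (k n : ℕ) : ℕ :=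
  Nat.card {π : n.Partition // IsSptDOOdd k π}

/-- `spt k'_{do}(n) = B₀(k,n) - B₁(k,n)`. -/
noncomputable def sptdo' (k n : ℕ) : ℤ :=
  (B0 k n : ℤ) - (B1 k n : ℤ)

/-- `p_d(n)`: number of partitions of `n` into distinct parts. -/
noncomputable def pd (n : ℕ) : ℕ :=
  Nat.card {π : n.Partition // π.parts.Nodup}

/-- `p_{de}(n)`: number of partitions of `n` into distinct even parts. -/
noncomputable def pde (n : ℕ) : ℕ :=
  Nat.card {π : n.Partition // π.parts.Nodup ∧ ∀ x ∈ π.parts, Even x}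

/-- `p_{do}(n)`: number of partitions of `n` into distinct odd parts. -/
noncomputable def pdo (n : ℕ) : ℕ :=
  Nat.card {π : n.Partition // π.parts.Nodup ∧ ∀ x ∈ π.parts, Odd x}

/-- `p'_{do}(n)`: partitions of `n` into an even number of distinct odd parts
minus those into an odd number of distinct odd parts. -/
noncomputable def pdo' (n : ℕ) : ℤ :=
  (Nat.card {π : n.Partition //
      π.parts.Nodup ∧ (∀ x ∈ π.parts, Odd x) ∧ Even (Multiset.card π.parts)} : ℤ) -
  (Nat.card {π : n.Partition //
      π.parts.Nodup ∧ (∀ x ∈ π.parts, Odd x) ∧ Odd (Multiset.card π.parts)} : ℤ)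

/-- Finite sets of integers greater than `s` with sum `m`, i.e. partitions of `m` into distinct
parts exceeding `s`. -/
def distinctAbove (s m : ℕ) : Finset (Finset ℕ) :=
  (Finset.Ioc s m).powerset.filter fun S => ∑ x ∈ S, x = m

theorem mem_distinctAbove {s m : ℕ} {S : Finset ℕ} :
    S ∈ distinctAbove s m ↔ (∀ x ∈ S, s < x) ∧ ∑ x ∈ S, x = m := by
  simp only [distinctAbove, Finset.mem_filter, Finset.mem_powerset, Finset.subset_iff,
    Finset.mem_Ioc]
  refine ⟨fun h => ⟨fun x hx => (h.1 hx).1, h.2⟩, fun h => ⟨fun x hx => ⟨h.1 x hx, ?_⟩, h.2⟩⟩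
  rw [← h.2]
  exact Finset.single_le_sum (f := fun x => x) (fun _ _ => Nat.zero_le _) hx

theorem distinctAbove_self {n : ℕ} (hn : 1 ≤ n) : distinctAbove n n = ∅ := by
  ext S
  simp only [distinctAbove, Finset.Ioc_self, Finset.mem_filter, Finset.mem_powerset,
    Finset.subset_empty, Finset.notMem_empty, iff_false, not_and]
  rintro rfl
  simp
  omega

/-- Split according to whether `s + 1` is a part. -/
theorem card_distinctAbove {s m : ℕ} (h : s + 1 ≤ m) :
    (distinctAbove s m).card =
      (distinctAbove (s + 1) m).card + (distinctAbove (s + 1) (m - (s + 1))).card := by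
  rw [← Finset.card_filter_add_card_filter_not (s := distinctAbove s m)
    (fun S => s + 1 ∉ S)]
  congr 1
  · congr 1
    ext S
    simp only [Finset.mem_filter, mem_distinctAbove]
    constructor
    · rintro ⟨⟨h1, h2⟩, h3⟩
      refine ⟨fun x hx => lt_of_le_of_ne (h1 x hx) ?_, h2⟩
      rintro rfl
      exact h3 hx
    · rintro ⟨h1, h2⟩
      exact ⟨⟨fun x hx => (Nat.lt_succ_self s).trans (h1 x hx), h2⟩,
        fun hs => lt_irrefl _ (h1 _ hs)⟩
  · refine Finset.card_nbij' (fun S => S.erase (s + 1)) (fun S => insert (s + 1) S) ?_ ?_ ?_ ?_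
    · intro S hS
      simp only [Finset.coe_filter, Set.mem_ofPred_eq, mem_distinctAbove, not_not] at hS
      obtain ⟨⟨h1, h2⟩, h3⟩ := hS
      simp only [Finset.mem_coe, mem_distinctAbove]
      refine ⟨fun x hx => ?_, ?_⟩
      · have := h1 x (Finset.mem_of_mem_erase hx)
        have := Finset.ne_of_mem_erase hx
        omega
      · have := Finset.add_sum_erase S (fun x => x) h3
        omega
    · intro S hS
      simp only [Finset.mem_coe, mem_distinctAbove] at hS
      have hs : s + 1 ∉ S := fun hs => lt_irrefl _ (hS.1 _ hs)
      simp only [Finset.coe_filter, Set.mem_ofPred_eq, mem_distinctAbove, not_not]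
      refine ⟨⟨fun x hx => ?_, ?_⟩, Finset.mem_insert_self _ _⟩
      · rcases Finset.mem_insert.1 hx with rfl | hx
        · omega
        · have := hS.1 x hx
          omega
      · rw [Finset.sum_insert hs, hS.2]
        omega
    · intro S hS
      simp only [Finset.coe_filter, Set.mem_ofPred_eq, not_not] at hS
      exact Finset.insert_erase hS.2
    · intro S hS
      simp only [Finset.mem_coe, mem_distinctAbove] at hS
      exact Finset.erase_insert fun hs => lt_irrefl _ (hS.1 _ hs)

theorem card_distinctAbove_zero_eq_sum_add {n t : ℕ} (ht : t ≤ n) :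
    (distinctAbove 0 n).card =
      ∑ s ∈ Finset.range t, (distinctAbove (s + 1) (n - (s + 1))).card +
        (distinctAbove t n).card := by
  induction t with
  | zero => simp
  | succ t ih =>
    rw [ih (by omega), Finset.sum_range_succ, card_distinctAbove ht]
    omega

/-- Split according to the smallest part. -/
theorem card_distinctAbove_zero {n : ℕ} (hn : 1 ≤ n) :
    (distinctAbove 0 n).card =
      ∑ s ∈ Finset.range n, (distinctAbove (s + 1) (n - (s + 1))).card := by
  rw [card_distinctAbove_zero_eq_sum_add le_rfl, distinctAbove_self hn, Finset.card_empty,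
    add_zero]

theorem pd_eq_card_distinctAbove (n : ℕ) : pd n = (distinctAbove 0 n).card := by
  classical
  rw [pd, Nat.card_eq_fintype_card, Fintype.card_subtype]
  refine Finset.card_bij (fun π _ => π.parts.toFinset) ?_ ?_ ?_
  · intro π hπ
    have hd := (Finset.mem_filter.1 hπ).2
    rw [mem_distinctAbove]
    refine ⟨fun x hx => π.parts_pos (Multiset.mem_toFinset.1 hx), ?_⟩
    have : (π.parts.toFinset).val = π.parts := by
      rw [Multiset.toFinset_val, Multiset.dedup_eq_self.2 hd]
    rw [Finset.sum, this, Multiset.map_id', π.parts_sum]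
  · intro π hπ ρ hρ h
    have hd := (Finset.mem_filter.1 hπ).2
    have hd' := (Finset.mem_filter.1 hρ).2
    have := congrArg Finset.val h
    rw [Multiset.toFinset_val, Multiset.toFinset_val, Multiset.dedup_eq_self.2 hd,
      Multiset.dedup_eq_self.2 hd'] at this
    exact Nat.Partition.ext this
  · intro S hS
    rw [mem_distinctAbove] at hS
    refine ⟨⟨S.val, fun {x} hx => hS.1 x hx, ?_⟩, ?_, ?_⟩
    · rw [← hS.2, Finset.sum, Multiset.map_id']
    · exact Finset.mem_filter.2 ⟨Finset.mem_univ _, S.nodup⟩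
    · exact S.val_toFinset

/-- The multiset with smallest part `s` repeated twice determines `s` and the other parts. -/
theorem cons_cons_val_inj {s t : ℕ} {S T : Finset ℕ} (hS : ∀ x ∈ S, s < x)
    (hT : ∀ x ∈ T, t < x) (h : s ::ₘ s ::ₘ S.val = t ::ₘ t ::ₘ T.val) : s = t ∧ S = T := by
  have h1 : s ∈ t ::ₘ t ::ₘ T.val := h ▸ Multiset.mem_cons_self _ _
  have h2 : t ∈ s ::ₘ s ::ₘ S.val := h ▸ Multiset.mem_cons_self _ _
  simp only [Multiset.mem_cons, Finset.mem_val] at h1 h2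
  have hst : s = t := by
    have := hS t
    have := hT s
    grind
  subst hst
  exact ⟨rfl, Finset.val_injective (by simpa using h)⟩

theorem sptd_two_eq_sum (n : ℕ) :
    sptd 2 n = ∑ s ∈ (Finset.range n).filter (fun s => 2 * (s + 1) ≤ n),
      (distinctAbove (s + 1) (n - 2 * (s + 1))).card := by
  classical
  rw [sptd, Nat.card_eq_fintype_card, Fintype.card_subtype, ← Finset.card_sigma]
  symm
  have key : ∀ p ∈ ((Finset.range n).filter (fun s => 2 * (s + 1) ≤ n)).sigma
      (fun s => distinctAbove (s + 1) (n - 2 * (s + 1))),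
      2 * (p.1 + 1) ≤ n ∧ (∀ x ∈ p.2, p.1 + 1 < x) ∧
        ∑ x ∈ p.2, x = n - 2 * (p.1 + 1) := by
    intro p hp
    rw [Finset.mem_sigma, Finset.mem_filter, mem_distinctAbove] at hp
    exact ⟨hp.1.2, hp.2⟩
  refine Finset.card_bij (fun p hp => ⟨(p.1 + 1) ::ₘ (p.1 + 1) ::ₘ p.2.val, ?_, ?_⟩) ?_ ?_ ?_
  · intro x hx
    have := (key p hp).2.1 x
    simp only [Multiset.mem_cons, Finset.mem_val] at hx
    grind
  · obtain ⟨h1, -, h3⟩ := key p hp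
    rw [Finset.sum, Multiset.map_id'] at h3
    rw [Multiset.sum_cons, Multiset.sum_cons, h3]
    omega
  · intro p hp
    obtain ⟨-, h2, -⟩ := key p hp
    have hs : p.1 + 1 ∉ p.2.val := fun h => lt_irrefl _ (h2 _ h)
    refine Finset.mem_filter.2 ⟨Finset.mem_univ _, p.1 + 1, Multiset.mem_cons_self _ _, ?_, ?_, ?_⟩
    · intro x hx
      have := h2 x
      simp only [Multiset.mem_cons, Finset.mem_val] at hx
      grind
    · simp only [Multiset.count_cons_self, Multiset.count_eq_zero_of_notMem hs]
    · intro x hx hne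
      simp only [Multiset.mem_cons, hne, false_or] at hx
      simp only [Multiset.count_cons_of_ne hne]
      exact Multiset.count_eq_one_of_mem p.2.nodup hx
  · rintro ⟨s, S⟩ hp ⟨t, T⟩ hq h
    obtain ⟨hst, rfl⟩ := cons_cons_val_inj (key _ hp).2.1 (key _ hq).2.1
      (congrArg Nat.Partition.parts h)
    obtain rfl : s = t := Nat.succ_injective hst
    rfl
  · intro π hπ
    obtain ⟨s, hs, hmin, hcount, hone⟩ := (Finset.mem_filter.1 hπ).2
    have hpos := π.parts_pos hs
    have hparts : s ::ₘ s ::ₘ (π.parts.toFinset.erase s).val = π.parts := by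
      ext x
      by_cases hx : x = s
      · subst hx
        rw [Multiset.count_cons_self, Multiset.count_cons_self, hcount,
          Multiset.count_eq_zero_of_notMem (Finset.notMem_erase x _)]
      · rw [Multiset.count_cons_of_ne hx, Multiset.count_cons_of_ne hx]
        by_cases hm : x ∈ π.parts
        · rw [hone x hm hx]
          exact Multiset.count_eq_one_of_mem (Finset.nodup _)
            (Finset.mem_erase.2 ⟨hx, Multiset.mem_toFinset.2 hm⟩)
        · rw [Multiset.count_eq_zero_of_notMem hm, Multiset.count_eq_zero_of_notMem]
          exact fun h => hm (Multiset.mem_toFinset.1 (Finset.mem_of_mem_erase h))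
    have hsum := π.parts_sum
    rw [← hparts, Multiset.sum_cons, Multiset.sum_cons] at hsum
    obtain ⟨s, rfl⟩ : ∃ r, s = r + 1 := ⟨s - 1, by omega⟩
    refine ⟨⟨s, π.parts.toFinset.erase (s + 1)⟩, ?_, Nat.Partition.ext hparts⟩
    rw [Finset.mem_sigma, Finset.mem_filter, mem_distinctAbove, Finset.mem_range, Finset.sum,
      Multiset.map_id']
    dsimp only
    refine ⟨⟨by omega, by omega⟩, fun x hx => ?_, by omega⟩
    have hx' := Finset.mem_erase.1 hx
    exact lt_of_le_of_ne (hmin x (Multiset.mem_toFinset.1 hx'.2)) hx'.1.symm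

theorem pd_add_sptd_two {n : ℕ} (hn : 1 ≤ n) :
    pd n + sptd 2 n = ∑ s ∈ Finset.range n, (distinctAbove s (n - (s + 1))).card := by
  rw [pd_eq_card_distinctAbove, card_distinctAbove_zero hn, sptd_two_eq_sum, Finset.sum_filter,
    ← Finset.sum_add_distrib]
  refine Finset.sum_congr rfl fun s hs => ?_
  split_ifs with h
  · rw [card_distinctAbove (s := s) (m := n - (s + 1)) (by omega)]
    congr 3
    omega
  · simp only [distinctAbove]
    rw [Finset.Ioc_eq_empty_of_le (by omega), Finset.Ioc_eq_empty_of_le (by omega), add_zero]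

theorem statement3 (n : ℕ) (hn : 2 ≤ n) :
    (sptd 2 n : ℤ) = 2 * pd (n - 1) - pd n := by
  obtain ⟨m, rfl⟩ : ∃ m, n = m + 1 := ⟨n - 1, by omega⟩
  have h := pd_add_sptd_two (n := m + 1) (by omega)
  rw [Finset.sum_range_succ'] at h
  simp only [Nat.add_sub_add_right, Nat.sub_zero] at h
  rw [← card_distinctAbove_zero (by omega), ← pd_eq_card_distinctAbove] at h
  rw [Nat.add_sub_cancel]
  omega
end

section
/- For every integer n ≥ 4, spt_3^d(n) = 2·p_d(n−3) − 2·p_d(n−1) + p_d(n). -/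
/-- Counting partitions of `n` with a property of the parts is counting multisets of positive
integers of sum `n` with that property. -/
theorem natCard_partition_eq_ncard (n : ℕ) (P : Multiset ℕ → Prop) :
    Nat.card {π : n.Partition // P π.parts} =
      {m : Multiset ℕ | (∀ i ∈ m, 0 < i) ∧ m.sum = n ∧ P m}.ncard := by
  rw [← Nat.card_coe_set_eq]
  exact Nat.card_congr
    { toFun := fun π => ⟨π.1.parts, fun _ hi => π.1.parts_pos hi, π.1.parts_sum, π.2⟩
      invFun := fun m => ⟨⟨m.1, fun {i} hi => m.2.1 i hi, m.2.2.1⟩, m.2.2.2⟩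
      left_inv := fun _ => rfl
      right_inv := fun _ => rfl }

/-- Pairs `(s, T)` of a positive integer and a finite set of integers above `s`, with
`k * s + ∑ T = n`. -/
def smallestPartPairs (k n : ℕ) : Set (ℕ × Finset ℕ) :=
  {p | 0 < p.1 ∧ (∀ x ∈ p.2, p.1 < x) ∧ k * p.1 + ∑ x ∈ p.2, x = n}

/-- As `smallestPartPairs`, but `s` itself may belong to `T`. -/
def weakSmallestPartPairs (k n : ℕ) : Set (ℕ × Finset ℕ) :=
  {p | 0 < p.1 ∧ (∀ x ∈ p.2, p.1 ≤ x) ∧ k * p.1 + ∑ x ∈ p.2, x = n}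

/-- Finite sets of positive integers of sum `n`. -/
def distinctPartSets (n : ℕ) : Set (Finset ℕ) :=
  {T | (∀ x ∈ T, 0 < x) ∧ ∑ x ∈ T, x = n}

theorem finite_weakSmallestPartPairs {k : ℕ} (hk : 0 < k) (n : ℕ) :
    (weakSmallestPartPairs k n).Finite := by
  refine (Finset.finite_toSet (Finset.range (n + 1) ×ˢ (Finset.range (n + 1)).powerset)).subset ?_
  rintro ⟨s, T⟩ ⟨-, -, h⟩
  simp only [Finset.coe_product, Set.mem_prod, Finset.mem_coe, Finset.mem_range,
    Finset.mem_powerset] at h ⊢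
  refine ⟨by nlinarith [Nat.zero_le (∑ x ∈ T, x), Nat.mul_le_mul_right s hk], fun x hx => ?_⟩
  have := Finset.single_le_sum (f := fun x : ℕ => x) (fun _ _ => Nat.zero_le _) hx
  simp only [Finset.mem_range] at this ⊢
  omega

theorem smallestPartPairs_subset (k n : ℕ) :
    smallestPartPairs k n ⊆ weakSmallestPartPairs k n :=
  fun _ ⟨h0, h1, h2⟩ => ⟨h0, fun x hx => (h1 x hx).le, h2⟩

theorem pd_eq_ncard (n : ℕ) : pd n = (distinctPartSets n).ncard := by
  rw [pd, natCard_partition_eq_ncard n Multiset.Nodup,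
    ← Set.ncard_image_of_injective _ Finset.val_injective]
  congr 1
  ext m
  constructor
  · rintro ⟨h0, h1, h2⟩
    exact ⟨⟨m, h2⟩, ⟨h0, (Finset.sum_val ⟨m, h2⟩).symm.trans h1⟩, rfl⟩
  · rintro ⟨T, ⟨h0, h1⟩, rfl⟩
    exact ⟨h0, T.sum_val.trans h1, T.nodup⟩

theorem sptd_eq_ncard {k : ℕ} (hk : 0 < k) (n : ℕ) :
    sptd k n = (smallestPartPairs k n).ncard := by
  have hinj : Set.InjOn (fun p : ℕ × Finset ℕ => Multiset.replicate k p.1 + p.2.val)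
      (smallestPartPairs k n) := by
    rintro ⟨s, T⟩ ⟨-, hT, -⟩ ⟨t, U⟩ ⟨-, hU, -⟩ h
    dsimp only at h hT hU
    have hs : s ∈ Multiset.replicate k t + U.val := by
      rw [← h]; simp [Multiset.mem_replicate, hk.ne']
    have ht : t ∈ Multiset.replicate k s + T.val := by
      rw [h]; simp [Multiset.mem_replicate, hk.ne']
    simp only [Multiset.mem_add, Multiset.mem_replicate, Finset.mem_val] at hs ht
    have hst : s = t := by
      rcases hs with hs | hs
      · exact hs.2
      · rcases ht with ht | ht
        · exact ht.2.symm
        · exact absurd (hU s hs) (hT t ht).le.not_gt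
    subst hst
    rw [Finset.val_injective (add_left_cancel h)]
  rw [sptd, ← hinj.ncard_image]
  refine (natCard_partition_eq_ncard n fun m => ∃ s ∈ m, (∀ x ∈ m, s ≤ x) ∧
    Multiset.count s m = k ∧ ∀ x ∈ m, x ≠ s → Multiset.count x m = 1).trans ?_
  congr 1
  ext m
  constructor
  · rintro ⟨h0, h1, s, hs, hmin, hcount, hdist⟩
    have hm : Multiset.replicate k s + (m.toFinset.erase s).val = m := by
      ext x
      rw [Multiset.count_add, Multiset.count_replicate,
        Multiset.count_eq_of_nodup (m.toFinset.erase s).nodup]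
      simp only [Finset.mem_val, Finset.mem_erase, Multiset.mem_toFinset]
      by_cases hx : x = s
      · subst hx; simp [hcount]
      · by_cases hxm : x ∈ m
        · simp [hx, Ne.symm hx, hxm, hdist x hxm hx]
        · simp [Ne.symm hx, hxm]
    refine ⟨(s, m.toFinset.erase s), ⟨h0 s hs, fun x hx => ?_, ?_⟩, hm⟩
    · rw [Finset.mem_erase, Multiset.mem_toFinset] at hx
      exact lt_of_le_of_ne (hmin x hx.2) (Ne.symm hx.1)
    · have := congrArg Multiset.sum hm
      rw [h1, Multiset.sum_add, Multiset.sum_replicate] at this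
      exact (congrArg _ (Finset.sum_val _).symm).trans this
  · rintro ⟨⟨s, T⟩, ⟨h0, h1, h2⟩, rfl⟩
    dsimp only at h0 h1 h2 ⊢
    have hsT : s ∉ T := fun h => (h1 s h).false
    refine ⟨fun i hi => ?_, ?_, s,
      by simp [Multiset.mem_replicate, hk.ne'], fun x hx => ?_, ?_, fun x hx hxs => ?_⟩
    · simp only [Multiset.mem_add, Multiset.mem_replicate, Finset.mem_val] at hi
      rcases hi with hi | hi
      · exact hi.2 ▸ h0
      · exact h0.trans (h1 i hi)
    · rw [Multiset.sum_add, Multiset.sum_replicate]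
      exact h2 ▸ congrArg _ T.sum_val
    · simp only [Multiset.mem_add, Multiset.mem_replicate, Finset.mem_val] at hx
      rcases hx with hx | hx
      · exact hx.2.ge
      · exact (h1 x hx).le
    · simp [hsT]
    · simp only [Multiset.mem_add, Multiset.mem_replicate, Finset.mem_val] at hx
      have hxT : x ∈ T := hx.resolve_left fun h => hxs h.2
      rw [Multiset.count_add, Multiset.count_replicate, if_neg (Ne.symm hxs),
        Multiset.count_eq_one_of_mem T.nodup hxT]

theorem ncard_weakSmallestPartPairs {k : ℕ} (hk : 0 < k) (n : ℕ) :
    (weakSmallestPartPairs k n).ncard =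
      (smallestPartPairs (k + 1) n).ncard + (smallestPartPairs k n).ncard := by
  have hinj : Set.InjOn (fun p : ℕ × Finset ℕ => (p.1, insert p.1 p.2))
      (smallestPartPairs (k + 1) n) := by
    rintro ⟨s, T⟩ ⟨-, hT, -⟩ ⟨t, U⟩ ⟨-, hU, -⟩ h
    simp only [Prod.mk.injEq] at h hT hU ⊢
    obtain ⟨rfl, h⟩ := h
    refine ⟨rfl, ?_⟩
    rw [← Finset.erase_insert (fun h => (hT s h).false : s ∉ T), h,
      Finset.erase_insert (fun h => (hU s h).false : s ∉ U)]
  have hunion : weakSmallestPartPairs k n =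
      (fun p : ℕ × Finset ℕ => (p.1, insert p.1 p.2)) '' smallestPartPairs (k + 1) n ∪
        smallestPartPairs k n := by
    ext ⟨s, T⟩
    constructor
    · rintro ⟨h0, h1, h2⟩
      dsimp only at h0 h1 h2
      by_cases hs : s ∈ T
      · refine Or.inl ⟨(s, T.erase s), ⟨h0, fun x hx => ?_, ?_⟩, ?_⟩
        · rw [Finset.mem_erase] at hx
          exact lt_of_le_of_ne (h1 x hx.2) (Ne.symm hx.1)
        · have := Finset.add_sum_erase T (fun x => x) hs
          dsimp only at this ⊢
          rw [← h2, ← this]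
          ring
        · simp [Finset.insert_erase hs]
      · refine Or.inr ⟨h0, fun x hx => lt_of_le_of_ne (h1 x hx) fun h => hs ?_, h2⟩
        exact (show s = x from h) ▸ hx
    · rintro (⟨⟨t, U⟩, ⟨h0, h1, h2⟩, h⟩ | h)
      · simp only [Prod.mk.injEq] at h h0 h1 h2
        obtain ⟨rfl, rfl⟩ := h
        refine ⟨h0, fun x hx => ?_, ?_⟩
        · rcases Finset.mem_insert.1 hx with hx | hx
          · exact hx.ge
          · exact (h1 x hx).le
        · dsimp only
          rw [Finset.sum_insert fun h => (h1 t h).false, ← h2]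
          ring
      · exact smallestPartPairs_subset k n h
  have hfin := finite_weakSmallestPartPairs hk n
  rw [hunion, Set.ncard_union_eq ?_ ?_ ?_, hinj.ncard_image]
  · rw [Set.disjoint_left]
    rintro _ ⟨⟨s, T⟩, -, rfl⟩ ⟨-, h, -⟩
    exact (h s (Finset.mem_insert_self s T)).false
  · exact hfin.subset (hunion ▸ Set.subset_union_left)
  · exact hfin.subset (smallestPartPairs_subset k n)

theorem ncard_weakSmallestPartPairs_eq_shift {k : ℕ} (hk : 0 < k) {n : ℕ} (hn : k ≤ n) :
    (weakSmallestPartPairs k n).ncard =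
      (distinctPartSets (n - k)).ncard + (smallestPartPairs k (n - k)).ncard := by
  have hinj₁ : Function.Injective fun T : Finset ℕ => ((1 : ℕ), T) :=
    fun _ _ h => (Prod.mk.inj h).2
  have hinj₂ : Function.Injective fun p : ℕ × Finset ℕ => (p.1 + 1, p.2) := by
    rintro ⟨s, T⟩ ⟨t, U⟩ h
    simpa using h
  have hunion : weakSmallestPartPairs k n =
      (fun T : Finset ℕ => ((1 : ℕ), T)) '' distinctPartSets (n - k) ∪
        (fun p : ℕ × Finset ℕ => (p.1 + 1, p.2)) '' smallestPartPairs k (n - k) := by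
    ext ⟨s, T⟩
    constructor
    · rintro ⟨h0, h1, h2⟩
      dsimp only at h0 h1 h2
      obtain ⟨s, rfl⟩ := Nat.exists_eq_succ_of_ne_zero h0.ne'
      rw [Nat.mul_succ] at h2
      rcases Nat.eq_zero_or_pos s with rfl | hs
      · exact Or.inl ⟨T, ⟨h1, by omega⟩, rfl⟩
      · exact Or.inr ⟨(s, T), ⟨hs, h1, by dsimp only; omega⟩, rfl⟩
    · rintro (⟨U, ⟨h1, h2⟩, h⟩ | ⟨⟨t, U⟩, ⟨h0, h1, h2⟩, h⟩)
      · simp only [Prod.mk.injEq] at h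
        obtain ⟨rfl, rfl⟩ := h
        exact ⟨one_pos, h1, by dsimp only; omega⟩
      · simp only [Prod.mk.injEq] at h h0 h1 h2
        obtain ⟨rfl, rfl⟩ := h
        exact ⟨Nat.succ_pos t, h1, by dsimp only; rw [Nat.mul_succ]; omega⟩
  have hfin := finite_weakSmallestPartPairs hk n
  rw [hunion, Set.ncard_union_eq ?_ ?_ ?_, Set.ncard_image_of_injective _ hinj₁,
    Set.ncard_image_of_injective _ hinj₂]
  · rw [Set.disjoint_left]
    rintro _ ⟨T, -, rfl⟩ ⟨⟨s, U⟩, ⟨h0, -, -⟩, h⟩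
    simp only [Prod.mk.injEq] at h h0
    omega
  · exact hfin.subset (hunion ▸ Set.subset_union_left)
  · exact hfin.subset (hunion ▸ Set.subset_union_right)

theorem sptd_succ_add_sptd {k : ℕ} (hk : 0 < k) {n : ℕ} (hn : k ≤ n) :
    sptd (k + 1) n + sptd k n = pd (n - k) + sptd k (n - k) := by
  rw [sptd_eq_ncard k.succ_pos, sptd_eq_ncard hk, sptd_eq_ncard hk, pd_eq_ncard,
    ← ncard_weakSmallestPartPairs hk, ncard_weakSmallestPartPairs_eq_shift hk hn]

theorem sptd_one {n : ℕ} (hn : 0 < n) : sptd 1 n = pd n := by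
  refine Nat.card_congr (Equiv.subtypeEquivRight fun π => ⟨?_, fun h => ?_⟩)
  · rintro ⟨s, -, -, hs, hdist⟩
    rw [Multiset.nodup_iff_count_le_one]
    intro x
    by_cases hx : x ∈ π.parts
    · by_cases hxs : x = s
      · exact hxs ▸ hs.le
      · exact (hdist x hx hxs).le
    · simp [hx]
  · have hne : π.parts.toFinset.Nonempty := by
      rw [Multiset.toFinset_nonempty]
      intro h0
      have := π.parts_sum
      simp only [h0, Multiset.sum_zero] at this
      omega
    obtain ⟨s, hs, hmin⟩ := Finset.exists_min_image _ id hne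
    simp only [Multiset.mem_toFinset, id] at hs hmin
    exact ⟨s, hs, hmin, Multiset.count_eq_one_of_mem h hs,
      fun x hx _ => Multiset.count_eq_one_of_mem h hx⟩

theorem sptd_two_add_pd {n : ℕ} (hn : 2 ≤ n) : sptd 2 n + pd n = 2 * pd (n - 1) := by
  have h := sptd_succ_add_sptd one_pos (n := n) (by omega)
  rw [sptd_one (by omega), sptd_one (by omega)] at h
  rw [two_mul]
  exact h

theorem statement4 (n : ℕ) (hn : 4 ≤ n) :
    (sptd 3 n : ℤ) = 2 * pd (n - 3) - 2 * pd (n - 1) + pd n := by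
  have h := sptd_succ_add_sptd two_pos (n := n) (by omega)
  have h₁ := sptd_two_add_pd (n := n) (by omega)
  have h₂ := sptd_two_add_pd (n := n - 2) (by omega)
  rw [show n - 2 - 1 = n - 3 by omega] at h₂
  norm_num at h
  omega
end

section
/- For every integer n ≥ 2, spt_1^{do}(n) = 2·p_{de}(n−1) + p_{do}(n−1). -/
/-- Partitions of `n` with distinct parts correspond to finite sets of positive integers with
sum `n`. -/
lemma card_partition_nodup (n : ℕ) (P : Finset ℕ → Prop) :
    Nat.card {π : n.Partition // π.parts.Nodup ∧ P π.parts.toFinset} =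
      {F : Finset ℕ | 0 ∉ F ∧ ∑ x ∈ F, x = n ∧ P F}.ncard := by
  rw [← Nat.card_coe_set_eq]
  refine Nat.card_congr
    { toFun := fun π => ⟨π.1.parts.toFinset, ?_, ?_, π.2.2⟩
      invFun := fun F => ⟨⟨F.1.val, ?_, ?_⟩, F.1.nodup, ?_⟩
      left_inv := ?_
      right_inv := ?_ }
  · intro h
    exact absurd (π.1.parts_pos (Multiset.mem_toFinset.1 h)) (lt_irrefl 0)
  · have h := π.1.parts_sum
    rw [Finset.sum_multiset_count_of_subset _ _ (Finset.Subset.refl _)] at h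
    refine Eq.trans ?_ h
    refine Finset.sum_congr rfl fun x hx => ?_
    rw [Multiset.count_eq_one_of_mem π.2.1 (Multiset.mem_toFinset.1 hx), one_smul]
  · intro i hi
    exact Nat.pos_of_ne_zero fun h => F.2.1 (h ▸ hi)
  · simpa using F.2.2.1
  · simpa using F.2.2.2
  · intro π
    ext1
    ext1
    simpa using π.2.1.dedup
  · intro F
    ext1
    simp

lemma finite_setOf_sum_eq (n : ℕ) (P : Finset ℕ → Prop) :
    {F : Finset ℕ | 0 ∉ F ∧ ∑ x ∈ F, x = n ∧ P F}.Finite := by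
  refine (Finset.range (n + 1)).powerset.finite_toSet.subset fun F hF => ?_
  simp only [Finset.coe_powerset, Set.mem_preimage, Set.mem_powerset_iff, Finset.coe_subset]
  intro x hx
  have := Finset.single_le_sum (f := fun x => x) (fun _ _ => Nat.zero_le _) hx
  simp only [hF.2.1] at this
  simpa [Nat.lt_succ_iff] using this

lemma isSptDO_one_iff {n : ℕ} (π : n.Partition) :
    IsSptDO 1 π ↔ π.parts.Nodup ∧ ∃ s ∈ π.parts.toFinset, (∀ x ∈ π.parts.toFinset, s ≤ x) ∧
      ∀ x ∈ π.parts.toFinset, x ≠ s → ¬ x % 2 = s % 2 := by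
  simp only [IsSptDO, Multiset.mem_toFinset]
  constructor
  · rintro ⟨s, hs, hle, hc, h⟩
    refine ⟨Multiset.nodup_iff_count_le_one.2 fun x => ?_, s, hs, hle, fun x hx hne => (h x hx hne).2⟩
    by_cases hx : x ∈ π.parts
    · by_cases hxs : x = s
      · rw [hxs, hc]
      · exact (h x hx hxs).1.le
    · simp [Multiset.count_eq_zero_of_notMem hx]
  · rintro ⟨hd, s, hs, hle, h⟩
    exact ⟨s, hs, hle, Multiset.count_eq_one_of_mem hd hs,
      fun x hx hne => ⟨Multiset.count_eq_one_of_mem hd hx, h x hx hne⟩⟩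

lemma injOn_insert_lt :
    Set.InjOn (fun p : ℕ × Finset ℕ => insert p.1 p.2) {p | ∀ x ∈ p.2, p.1 < x} := by
  rintro ⟨s, T⟩ h ⟨t, U⟩ h' he
  simp only [Set.mem_ofPred_eq] at h h' he
  have hs : s ∈ insert t U := he ▸ Finset.mem_insert_self s T
  have ht : t ∈ insert s T := he ▸ Finset.mem_insert_self t U
  have hst : s = t := by
    rcases Finset.mem_insert.1 hs with hs | hs
    · exact hs
    rcases Finset.mem_insert.1 ht with ht | ht
    · exact ht.symm
    exact absurd (h t ht) (h' s hs).not_gt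
  subst hst
  have hT : s ∉ T := fun hm => lt_irrefl _ (h s hm)
  have hU : s ∉ U := fun hm => lt_irrefl _ (h' s hm)
  rw [← Finset.erase_insert hT, he, Finset.erase_insert hU]

/-- Pairs of a minimum `s` and a set of larger integers of the same parity, of total sum `m`. -/
def sameParityPairs (m : ℕ) : Set (ℕ × Finset ℕ) :=
  {p | (∀ x ∈ p.2, p.1 < x ∧ x % 2 = p.1 % 2) ∧ p.1 + ∑ x ∈ p.2, x = m}

lemma ncard_image_insert_succ (m : ℕ) :
    ((fun p : ℕ × Finset ℕ => insert (p.1 + 1) p.2) '' sameParityPairs m).ncard =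
      (sameParityPairs m).ncard := by
  refine Set.InjOn.ncard_image ?_
  have hmaps : Set.MapsTo (fun p : ℕ × Finset ℕ => (p.1 + 1, p.2)) (sameParityPairs m)
      {p | ∀ x ∈ p.2, p.1 < x} := by
    intro p hp x hx
    have := hp.1 x hx
    simp only
    omega
  refine injOn_insert_lt.comp (fun p _ q _ h => ?_) hmaps
  simp only [Prod.mk.injEq, add_left_inj] at h
  exact Prod.ext h.1 h.2

lemma ncard_image_insert (m : ℕ) :
    ((fun p : ℕ × Finset ℕ => insert p.1 p.2) '' sameParityPairs m).ncard =
      (sameParityPairs m).ncard :=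
  Set.InjOn.ncard_image (injOn_insert_lt.mono fun _ hp x hx => (hp.1 x hx).1)

lemma image_insert_succ_eq (m : ℕ) :
    (fun p : ℕ × Finset ℕ => insert (p.1 + 1) p.2) '' sameParityPairs m =
      {F | 0 ∉ F ∧ ∑ x ∈ F, x = m + 1 ∧ ∃ s ∈ F, (∀ x ∈ F, s ≤ x) ∧
        ∀ x ∈ F, x ≠ s → ¬ x % 2 = s % 2} := by
  ext F
  constructor
  · rintro ⟨⟨s, T⟩, ⟨h, hsum⟩, rfl⟩
    simp only at h hsum ⊢
    have hs : s + 1 ∉ T := fun hm => by have := h _ hm; omega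
    refine ⟨?_, ?_, s + 1, Finset.mem_insert_self _ _, ?_, ?_⟩
    · intro h0
      rcases Finset.mem_insert.1 h0 with h0 | h0
      · omega
      · have := h _ h0; omega
    · rw [Finset.sum_insert hs]; omega
    · intro x hx
      rcases Finset.mem_insert.1 hx with hx | hx
      · omega
      · have := h _ hx; omega
    · intro x hx hne
      rcases Finset.mem_insert.1 hx with hx | hx
      · omega
      · have := h _ hx; omega
  · rintro ⟨h0, hsum, s, hs, hle, hpar⟩
    obtain ⟨t, rfl⟩ : ∃ t, s = t + 1 := Nat.exists_eq_succ_of_ne_zero fun h => h0 (h ▸ hs)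
    refine ⟨(t, F.erase (t + 1)), ⟨fun x hx => ?_, ?_⟩, Finset.insert_erase hs⟩
    · have hx' := Finset.mem_erase.1 hx
      have h1 := hle x hx'.2
      have h2 := hpar x hx'.2 hx'.1
      simp only
      omega
    · have := Finset.add_sum_erase F (fun x => x) hs
      simp only at this ⊢
      omega

lemma image_insert_eq (m : ℕ) (hm : 1 ≤ m) :
    (fun p : ℕ × Finset ℕ => insert p.1 p.2) '' sameParityPairs m =
      ({F | 0 ∉ F ∧ ∑ x ∈ F, x = m ∧ ∀ x ∈ F, Even x} ∪
        insert 0 '' {F | 0 ∉ F ∧ ∑ x ∈ F, x = m ∧ ∀ x ∈ F, Even x}) ∪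
      {F | 0 ∉ F ∧ ∑ x ∈ F, x = m ∧ ∀ x ∈ F, Odd x} := by
  ext F
  have key : F ∈ (fun p : ℕ × Finset ℕ => insert p.1 p.2) '' sameParityPairs m ↔
      ∑ x ∈ F, x = m ∧ ((∀ x ∈ F, Even x) ∨ ∀ x ∈ F, Odd x) := by
    constructor
    · rintro ⟨⟨s, T⟩, ⟨h, hsum⟩, rfl⟩
      simp only at h hsum ⊢
      refine ⟨?_, ?_⟩
      · rw [Finset.sum_insert fun hm => lt_irrefl _ (h _ hm).1, hsum]
      · simp only [Finset.forall_mem_insert, Nat.even_iff, Nat.odd_iff]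
        rcases Nat.mod_two_eq_zero_or_one s with hs | hs
        · exact Or.inl ⟨hs, fun x hx => (h x hx).2.trans hs⟩
        · exact Or.inr ⟨hs, fun x hx => (h x hx).2.trans hs⟩
    · rintro ⟨hsum, hpar⟩
      have hne : F.Nonempty := by
        rw [Finset.nonempty_iff_ne_empty]
        rintro rfl
        simp at hsum
        omega
      have hmem := F.min'_mem hne
      refine ⟨(F.min' hne, F.erase (F.min' hne)), ⟨fun x hx => ⟨?_, ?_⟩, ?_⟩,
        Finset.insert_erase hmem⟩
      · exact F.min'_lt_of_mem_erase_min' hne hx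
      · have hxF := Finset.mem_of_mem_erase hx
        simp only [Nat.even_iff, Nat.odd_iff] at hpar
        rcases hpar with hpar | hpar <;> exact (hpar x hxF).trans (hpar _ hmem).symm
      · exact (Finset.add_sum_erase F (fun x => x) hmem).trans hsum
  rw [key]
  constructor
  · rintro ⟨hsum, hpar | hpar⟩
    · by_cases h0 : 0 ∈ F
      · refine Or.inl (Or.inr ⟨F.erase 0, ⟨Finset.notMem_erase 0 F, ?_, ?_⟩,
          Finset.insert_erase h0⟩)
        · rw [← hsum, ← Finset.add_sum_erase F (fun x => x) h0, zero_add]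
        · exact fun x hx => hpar x (Finset.mem_of_mem_erase hx)
      · exact Or.inl (Or.inl ⟨h0, hsum, hpar⟩)
    · exact Or.inr ⟨fun h0 => by simpa using hpar 0 h0, hsum, hpar⟩
  · rintro ((⟨-, hsum, hpar⟩ | ⟨G, ⟨h0, hsum, hpar⟩, rfl⟩) | ⟨-, hsum, hpar⟩)
    · exact ⟨hsum, Or.inl hpar⟩
    · refine ⟨by rw [Finset.sum_insert h0, hsum, zero_add], Or.inl ?_⟩
      simpa [Finset.forall_mem_insert] using hpar
    · exact ⟨hsum, Or.inr hpar⟩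

lemma ncard_sameParityPairs (m : ℕ) (hm : 1 ≤ m) :
    (sameParityPairs m).ncard =
      2 * {F : Finset ℕ | 0 ∉ F ∧ ∑ x ∈ F, x = m ∧ ∀ x ∈ F, Even x}.ncard +
        {F : Finset ℕ | 0 ∉ F ∧ ∑ x ∈ F, x = m ∧ ∀ x ∈ F, Odd x}.ncard := by
  have hE := finite_setOf_sum_eq m fun F => ∀ x ∈ F, Even x
  have hO := finite_setOf_sum_eq m fun F => ∀ x ∈ F, Odd x
  rw [← ncard_image_insert, image_insert_eq m hm, Set.ncard_union_eq ?_ (hE.union (hE.image _)) hO,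
    Set.ncard_union_eq ?_ hE (hE.image _), Set.InjOn.ncard_image, two_mul]
  · intro F hF G hG h
    rw [← Finset.erase_insert hF.1, h, Finset.erase_insert hG.1]
  · rw [Set.disjoint_left]
    rintro _ hF ⟨G, -, rfl⟩
    exact hF.1 (Finset.mem_insert_self 0 G)
  · rw [Set.disjoint_left]
    rintro F (hF | ⟨G, -, rfl⟩) hF'
    · obtain rfl | ⟨x, hx⟩ := F.eq_empty_or_nonempty
      · have := hF.2.1
        simp at this
        omega
      · exact Nat.not_even_iff_odd.2 (hF'.2.2 x hx) (hF.2.2 x hx)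
    · exact hF'.1 (Finset.mem_insert_self 0 G)

theorem statement5 (n : ℕ) (hn : 2 ≤ n) :
    sptdo 1 n = 2 * pde (n - 1) + pdo (n - 1) := by
  obtain ⟨m, rfl⟩ : ∃ m, n = m + 1 := ⟨n - 1, by omega⟩
  have hE := card_partition_nodup m fun F => ∀ x ∈ F, Even x
  have hO := card_partition_nodup m fun F => ∀ x ∈ F, Odd x
  have hS := card_partition_nodup (m + 1) fun F =>
    ∃ s ∈ F, (∀ x ∈ F, s ≤ x) ∧ ∀ x ∈ F, x ≠ s → ¬ x % 2 = s % 2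
  simp only [← isSptDO_one_iff] at hS
  simp only [Multiset.mem_toFinset] at hE hO
  rw [Nat.add_sub_cancel, sptdo, pde, pdo, hS, hE, hO, ← image_insert_succ_eq,
    ncard_image_insert_succ, ncard_sameParityPairs m (by omega)]
end

section
/- For every integer n ≥ 2, spt_1'^{do}(n) = −p'_{do}(n−1). -/
open Finset Polynomial in
/-- The coefficients of `∏ j ∈ S, (1 - X ^ j)` count the subsets of `S` with prescribed sum,
signed by the parity of their cardinality. -/
theorem coeff_prod_one_sub_X_pow (S : Finset ℕ) (m : ℕ) :
    (∏ j ∈ S, (1 - X ^ j : ℤ[X])).coeff m =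
      (#{u ∈ S.powerset | ∑ j ∈ u, j = m ∧ Even #u} : ℤ) -
        (#{u ∈ S.powerset | ∑ j ∈ u, j = m ∧ Odd #u} : ℤ) := by
  simp only [sub_eq_add_neg (1 : ℤ[X]), prod_one_add, finsetSum_coeff, card_filter, Nat.cast_sum,
    ← sum_sub_distrib]
  refine sum_congr rfl fun u _ => ?_
  have h : ∏ j ∈ u, (-X ^ j : ℤ[X]) = C ((-1) ^ #u) * X ^ (∑ j ∈ u, j) := by
    rw [prod_neg, prod_pow_eq_pow_sum]
    simp
  rw [h, coeff_C_mul, coeff_X_pow]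
  rcases Nat.even_or_odd #u with he | ho
  · simp [he, Nat.not_odd_iff_even.2 he, eq_comm]
  · by_cases hm : m = ∑ j ∈ u, j
    · simp [ho, Nat.not_even_iff_odd.2 ho, hm]
    · simp [hm, eq_comm]

/-- The integers in `[s, M]` congruent to `s` modulo 2. -/
def sameParityIcc (M s : ℕ) : Finset ℕ := {j ∈ Finset.Icc s M | j % 2 = s % 2}

theorem mem_sameParityIcc {M s j : ℕ} :
    j ∈ sameParityIcc M s ↔ (s ≤ j ∧ j ≤ M) ∧ j % 2 = s % 2 := by
  simp [sameParityIcc]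

open Polynomial in
theorem X_pow_mul_prod_sameParityIcc {M s : ℕ} (h : s ≤ M) :
    X ^ s * ∏ j ∈ sameParityIcc M (s + 2), (1 - X ^ j : ℤ[X]) =
      ∏ j ∈ sameParityIcc M (s + 2), (1 - X ^ j) - ∏ j ∈ sameParityIcc M s, (1 - X ^ j) := by
  have hS : sameParityIcc M s = insert s (sameParityIcc M (s + 2)) := by
    ext j
    simp only [mem_sameParityIcc, Finset.mem_insert]
    omega
  rw [hS, Finset.prod_insert (by simp [mem_sameParityIcc])]
  ring

open Polynomial in
theorem sum_X_pow_mul_prod_sameParityIcc (M : ℕ) :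
    ∑ s ∈ Finset.range (M + 1), X ^ s * ∏ j ∈ sameParityIcc M (s + 2), (1 - X ^ j : ℤ[X]) =
      2 - ∏ j ∈ sameParityIcc M 1, (1 - X ^ j) := by
  set P : ℕ → ℤ[X] := fun s => ∏ j ∈ sameParityIcc M s, (1 - X ^ j) with hP
  have htel : ∀ K, ∑ s ∈ Finset.range K, (P (s + 2) - P s) = P (K + 1) + P K - P 1 - P 0 := by
    intro K
    induction K with
    | zero => simp
    | succ K ih => rw [Finset.sum_range_succ, ih]; ring
  have hone : ∀ s, M < s → P s = 1 := by
    intro s hs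
    refine Finset.prod_eq_one fun j hj => ?_
    rw [mem_sameParityIcc] at hj
    omega
  have hzero : P 0 = 0 := Finset.prod_eq_zero (i := 0) (by simp [mem_sameParityIcc]) (by simp)
  calc _ = ∑ s ∈ Finset.range (M + 1), (P (s + 2) - P s) :=
        Finset.sum_congr rfl fun s hs =>
          X_pow_mul_prod_sameParityIcc (Nat.lt_succ_iff.1 (Finset.mem_range.1 hs))
    _ = _ := by
        rw [htel, hone _ (by omega), hone _ (by omega), hzero]
        ring

/-- Partitions of `n` whose parts satisfy `R`, counted through an injective parametrization. -/
theorem Nat.Partition.natCard_subtype_eq_card {γ : Type*} {n : ℕ} (R : Multiset ℕ → Prop)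
    (Z : Finset γ) (f : γ → Multiset ℕ) (hf : Set.InjOn f Z)
    (hR : ∀ p, (∃ z ∈ Z, f z = p) ↔ p.sum = n ∧ (∀ x ∈ p, 0 < x) ∧ R p) :
    Nat.card {π : n.Partition // R π.parts} = Z.card := by
  classical
  rw [← Finset.card_image_of_injOn hf, ← Nat.card_eq_finsetCard]
  refine Nat.card_congr
    { toFun := fun π => ⟨π.1.parts, ?_⟩
      invFun := fun p => ⟨⟨p.1, ?_, ?_⟩, ?_⟩
      left_inv := fun _ => rfl
      right_inv := fun _ => rfl }
  · simpa using (hR _).2 ⟨π.1.parts_sum, fun _ => π.1.parts_pos, π.2⟩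
  · exact fun {i} hi => ((hR _).1 (Finset.mem_image.1 p.2)).2.1 i hi
  · exact ((hR _).1 (Finset.mem_image.1 p.2)).1
  · exact ((hR _).1 (Finset.mem_image.1 p.2)).2.2

open Finset in
theorem natCard_distinct_odd (M m : ℕ) (h : m ≤ M) (E : ℕ → Prop) [DecidablePred E] :
    Nat.card {π : m.Partition //
        π.parts.Nodup ∧ (∀ x ∈ π.parts, Odd x) ∧ E (Multiset.card π.parts)} =
      #{u ∈ (sameParityIcc M 1).powerset | ∑ j ∈ u, j = m ∧ E #u} := by
  refine Nat.Partition.natCard_subtype_eq_card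
    (fun p => p.Nodup ∧ (∀ x ∈ p, Odd x) ∧ E (Multiset.card p)) _ Finset.val
    Finset.val_injective.injOn fun p => ?_
  simp only [mem_filter, mem_powerset]
  constructor
  · rintro ⟨u, ⟨hu, hs, hE⟩, rfl⟩
    have hu' := fun x (hx : x ∈ u) => mem_sameParityIcc.1 (hu hx)
    refine ⟨by rw [← hs, Finset.sum_eq_multiset_sum, Multiset.map_id'],
      fun x hx => (hu' x hx).1.1, u.nodup, fun x hx => ?_, hE⟩
    exact Nat.odd_iff.2 (hu' x hx).2
  · rintro ⟨hs, -, hn, ho, hE⟩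
    refine ⟨⟨p, hn⟩, ⟨fun x hx => ?_, ?_, hE⟩, rfl⟩
    · have := Multiset.le_sum_of_mem (show x ∈ p from hx)
      have := Nat.odd_iff.1 (ho x hx)
      rw [mem_sameParityIcc]
      omega
    · rw [← hs, Finset.sum_eq_multiset_sum, Multiset.map_id']

open Finset in
theorem natCard_unique_min_opposite_parity (n : ℕ) (E : ℕ → Prop) [DecidablePred E] :
    Nat.card {π : n.Partition // ∃ s ∈ π.parts, (∀ x ∈ π.parts, s ≤ x) ∧
        Multiset.count s π.parts = 1 ∧
        (∀ x ∈ π.parts, x ≠ s → Multiset.count x π.parts = 1 ∧ ¬ x % 2 = s % 2) ∧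
        E (Multiset.card (π.parts.filter fun x => s < x))} =
      ∑ s ∈ range n,
        #{u ∈ (sameParityIcc n (s + 2)).powerset | s + 1 + ∑ j ∈ u, j = n ∧ E #u} := by
  rw [← card_sigma]
  refine Nat.Partition.natCard_subtype_eq_card
    (fun p => ∃ s ∈ p, (∀ x ∈ p, s ≤ x) ∧ Multiset.count s p = 1 ∧
        (∀ x ∈ p, x ≠ s → Multiset.count x p = 1 ∧ ¬ x % 2 = s % 2) ∧
        E (Multiset.card (p.filter fun x => s < x)))
    _ (fun z => (z.1 + 1) ::ₘ z.2.val) ?_ fun p => ?_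
  · rintro ⟨s, u⟩ hz ⟨t, v⟩ hz' he
    simp only [coe_sigma, Set.mem_sigma_iff, mem_coe, mem_filter, mem_powerset] at hz hz' he
    have hst : s = t := by
      have h1 : s + 1 ∈ (t + 1) ::ₘ v.val := by rw [← he]; simp
      have h2 : t + 1 ∈ (s + 1) ::ₘ u.val := by rw [he]; simp
      rw [Multiset.mem_cons] at h1 h2
      rcases h1 with h1 | h1
      · omega
      rcases h2 with h2 | h2
      · omega
      have := mem_sameParityIcc.1 (hz'.2.1 h1)
      have := mem_sameParityIcc.1 (hz.2.1 h2)
      omega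
    subst hst
    rw [Multiset.cons_inj_right, Finset.val_inj] at he
    rw [he]
  · simp only [mem_sigma, mem_filter, mem_powerset, mem_range, Sigma.exists]
    constructor
    · rintro ⟨s, u, ⟨hs, hu, hsum, hE⟩, rfl⟩
      have hu' := fun x (hx : x ∈ u) => mem_sameParityIcc.1 (hu hx)
      have hsu : s + 1 ∉ u := fun h => by have := hu' _ h; omega
      refine ⟨?_, ?_, s + 1, by simp, ?_, ?_, ?_, ?_⟩
      · rw [← hsum, Finset.sum_eq_multiset_sum, Multiset.map_id', Multiset.sum_cons]
      · intro x hx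
        rcases Multiset.mem_cons.1 hx with rfl | hx
        · omega
        · have := hu' x hx; omega
      · intro x hx
        rcases Multiset.mem_cons.1 hx with rfl | hx
        · omega
        · have := hu' x hx; omega
      · rw [Multiset.count_cons_self, Multiset.count_eq_zero_of_notMem hsu]
      · intro x hx hne
        have hx' := (Multiset.mem_cons.1 hx).resolve_left hne
        rw [Multiset.count_cons_of_ne hne]
        refine ⟨Multiset.count_eq_one_of_mem u.nodup hx', ?_⟩
        have := hu' x hx'; omega
      · rw [Multiset.filter_cons_of_neg _ (by omega), Multiset.filter_eq_self.2]
        · exact hE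
        · intro x hx
          have := hu' x hx; omega
    · rintro ⟨hsum, hpos, s, hs, hmin, hc, hrest, hE⟩
      obtain ⟨q, rfl⟩ := Multiset.exists_cons_of_mem hs
      have hs0 := hpos s hs
      obtain ⟨t, rfl⟩ : ∃ t, s = t + 1 := ⟨s - 1, by omega⟩
      rw [Multiset.count_cons_self, Nat.add_eq_right, Multiset.count_eq_zero] at hc
      have hne : ∀ x ∈ q, x ≠ t + 1 := fun x hx h => hc (h ▸ hx)
      have hq : q.Nodup := by
        rw [Multiset.nodup_iff_count_eq_one]
        intro x hx
        rw [← (hrest x (Multiset.mem_cons_of_mem hx) (hne x hx)).1,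
          Multiset.count_cons_of_ne (hne x hx)]
      rw [Multiset.sum_cons] at hsum
      refine ⟨t, ⟨q, hq⟩, ⟨by omega, fun x hx => ?_, ?_, ?_⟩, rfl⟩
      · have hx' := Multiset.mem_cons_of_mem (b := t + 1) (show x ∈ q from hx)
        have := Multiset.le_sum_of_mem (show x ∈ q from hx)
        have := hmin x hx'
        have := hne x hx
        have := (hrest x hx' this).2
        rw [mem_sameParityIcc]
        omega
      · rw [← hsum, Finset.sum_eq_multiset_sum, Multiset.map_id']
      · rw [Multiset.filter_cons_of_neg _ (by omega), Multiset.filter_eq_self.2] at hE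
        · exact hE
        · intro x hx
          have := hmin x (Multiset.mem_cons_of_mem hx)
          have := hne x hx
          omega

theorem statement6 (n : ℕ) (hn : 2 ≤ n) :
    sptdo' 1 n = -pdo' (n - 1) := by
  have hpdo : pdo' (n - 1) =
      (∏ j ∈ sameParityIcc n 1, (1 - Polynomial.X ^ j : Polynomial ℤ)).coeff (n - 1) := by
    rw [coeff_prod_one_sub_X_pow, pdo', natCard_distinct_odd n _ (by omega) Even,
      natCard_distinct_odd n _ (by omega) Odd]
  have hspt : sptdo' 1 n = (∑ s ∈ Finset.range (n + 1), Polynomial.X ^ s *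
      ∏ j ∈ sameParityIcc n (s + 2), (1 - Polynomial.X ^ j : Polynomial ℤ)).coeff (n - 1) := by
    have h0 := natCard_unique_min_opposite_parity n Even
    have h1 := natCard_unique_min_opposite_parity n Odd
    simp only [sptdo', B0, B1, IsSptDOEven, IsSptDOOdd]
    rw [h0, h1, Finset.sum_range_succ, Polynomial.coeff_add, Polynomial.finsetSum_coeff,
      Polynomial.coeff_X_pow_mul', if_neg (by omega), add_zero, Nat.cast_sum, Nat.cast_sum,
      ← Finset.sum_sub_distrib]
    refine Finset.sum_congr rfl fun s hs => ?_
    rw [Finset.mem_range] at hs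
    rw [Polynomial.coeff_X_pow_mul', if_pos (by omega), coeff_prod_one_sub_X_pow]
    have h : ∀ k, s + 1 + k = n ↔ k = n - 1 - s := fun k => by omega
    simp only [h]
  have h2 : (2 : Polynomial ℤ).coeff (n - 1) = 0 := by
    obtain ⟨m, rfl⟩ := Nat.exists_eq_add_of_le hn
    rw [show 2 + m - 1 = m + 1 by omega, Polynomial.coeff_ofNat_succ]
  rw [hspt, sum_X_pow_mul_prod_sameParityIcc, Polynomial.coeff_sub, h2, hpdo, zero_sub]
end

section
/- For every integer n ≥ 5, spt_2'^{do}(n) = p'_{do}(n−4) − p'_{do}(n−3) − p'_{do}(n−2). -/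
open Polynomial in
/-- The truncation `∏ (1 - X ^ x)`, over `m ≤ x ≤ M` with `x ≡ m` modulo 2, of the
`q`-Pochhammer symbol `(q ^ m; q ^ 2)_∞`. -/
noncomputable def qPochTwo (M m : ℕ) : ℤ[X] :=
  ∏ x ∈ (Finset.Icc m M).filter (fun x => x % 2 = m % 2), (1 - X ^ x)

section qPochTwo

open Polynomial Finset

theorem qPochTwo_of_lt {M m : ℕ} (h : M < m) : qPochTwo M m = 1 := by
  simp [qPochTwo, h]

theorem qPochTwo_zero (M : ℕ) : qPochTwo M 0 = 0 :=
  prod_eq_zero (i := 0) (by simp) (by simp)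

theorem qPochTwo_step {M m : ℕ} (h : m ≤ M) :
    qPochTwo M m = (1 - X ^ m) * qPochTwo M (m + 2) := by
  have hs : (Icc m M).filter (fun x => x % 2 = m % 2) =
      insert m ((Icc (m + 2) M).filter fun x => x % 2 = (m + 2) % 2) := by
    ext x
    simp only [mem_filter, mem_Icc, mem_insert]
    omega
  rw [qPochTwo, hs, prod_insert (by simp), qPochTwo]

theorem sum_range_add_two_sub {A : Type*} [AddCommGroup A] (f : ℕ → A) (K : ℕ) :
    ∑ m ∈ range K, (f (m + 2) - f m) = f (K + 1) + f K - f 0 - f 1 := by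
  induction K with
  | zero => simp
  | succ K ih => rw [sum_range_succ, ih]; abel

theorem sum_X_pow_mul_qPochTwo (M : ℕ) :
    ∑ m ∈ range (M + 1), X ^ (2 * (m + 1)) * qPochTwo M (m + 2) =
      X ^ (M + 4) + X ^ (M + 3) + 2 * X ^ 2 - 2 * X ^ 4 +
        (X ^ 4 - X ^ 3 - X ^ 2) * qPochTwo M 1 := by
  have h₁ : ∑ m ∈ range (M + 1), X ^ m * qPochTwo M (m + 2) = 2 - qPochTwo M 1 := by
    have h := sum_range_add_two_sub (qPochTwo M) (M + 1)
    rw [qPochTwo_of_lt (by omega), qPochTwo_of_lt (by omega), qPochTwo_zero] at h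
    calc _ = ∑ m ∈ range (M + 1), (qPochTwo M (m + 2) - qPochTwo M m) := by
          refine sum_congr rfl fun m hm => ?_
          rw [qPochTwo_step (m := m) (by simpa [Nat.lt_succ_iff] using hm)]
          ring
      _ = _ := by rw [h]; ring
  have h₂ := sum_range_add_two_sub (fun m => X ^ m * qPochTwo M m) (M + 1)
  simp only [qPochTwo_zero] at h₂
  rw [qPochTwo_of_lt (m := M + 1 + 1) (by omega), qPochTwo_of_lt (m := M + 1) (by omega)] at h₂
  have h₃ : ∑ m ∈ range (M + 1), (X ^ (m + 2) * qPochTwo M (m + 2) - X ^ m * qPochTwo M m) =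
      (X ^ 2 - 1) * ∑ m ∈ range (M + 1), X ^ m * qPochTwo M (m + 2) +
        ∑ m ∈ range (M + 1), X ^ (2 * m) * qPochTwo M (m + 2) := by
    rw [mul_sum, ← sum_add_distrib]
    refine sum_congr rfl fun m hm => ?_
    rw [qPochTwo_step (m := m) (by simpa [Nat.lt_succ_iff] using hm)]
    ring
  have h₄ : ∑ m ∈ range (M + 1), X ^ (2 * (m + 1)) * qPochTwo M (m + 2) =
      X ^ 2 * ∑ m ∈ range (M + 1), X ^ (2 * m) * qPochTwo M (m + 2) := by
    rw [mul_sum]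
    exact sum_congr rfl fun m _ => by ring
  rw [h₄]
  rw [h₃, h₁] at h₂
  linear_combination X ^ 2 * h₂

theorem coeff_X_pow_mul_prod_one_sub (a n : ℕ) (U : Finset ℕ) :
    (X ^ a * ∏ x ∈ U, (1 - X ^ x) : ℤ[X]).coeff n =
      ∑ T ∈ U.powerset with a + ∑ x ∈ T, x = n, (-1) ^ #T := by
  have h : (X ^ a * ∏ x ∈ U, (1 - X ^ x) : ℤ[X]) =
      ∑ T ∈ U.powerset, C ((-1) ^ #T) * X ^ (a + ∑ x ∈ T, x) := by
    simp only [sub_eq_add_neg, prod_one_add, mul_sum]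
    refine sum_congr rfl fun T _ => ?_
    rw [prod_neg, prod_pow_eq_pow_sum, pow_add]
    simp only [map_pow, map_neg, map_one]
    ring
  rw [h, finsetSum_coeff, sum_filter]
  refine sum_congr rfl fun T _ => ?_
  rw [coeff_C_mul_X_pow]
  simp only [eq_comm]

end qPochTwo

section Counting

open Finset

theorem natCard_partition_eq_card {α : Type*} {n : ℕ} {Q : Multiset ℕ → Prop} (F : Finset α)
    (g : α → Multiset ℕ) (hg : Set.InjOn g F)
    (h : ∀ m, (∃ a ∈ F, g a = m) ↔ (∀ x ∈ m, 0 < x) ∧ m.sum = n ∧ Q m) :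
    Nat.card {π : n.Partition // Q π.parts} = #F := by
  have hF : ∀ a ∈ F, (∀ x ∈ g a, 0 < x) ∧ (g a).sum = n ∧ Q (g a) :=
    fun a ha => (h _).1 ⟨a, ha, rfl⟩
  let φ : F → {π : n.Partition // Q π.parts} := fun a =>
    ⟨⟨g a, fun {i} hi => (hF a a.2).1 i hi, (hF a a.2).2.1⟩, (hF a a.2).2.2⟩
  have hφ : Function.Bijective φ := by
    constructor
    · intro a b hab
      exact Subtype.ext (hg a.2 b.2 (congrArg (fun π => π.1.parts) hab))
    · rintro ⟨π, hπ⟩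
      obtain ⟨a, ha, hm⟩ := (h π.parts).2 ⟨fun _ hx => π.parts_pos hx, π.parts_sum, hπ⟩
      exact ⟨⟨a, ha⟩, Subtype.ext (Nat.Partition.ext hm)⟩
  rw [← Nat.card_congr (Equiv.ofBijective φ hφ)]
  simp

theorem card_filter_even_sub_card_filter_odd {α : Type*} (F : Finset α) (c : α → ℕ) :
    (#{a ∈ F | Even (c a)} : ℤ) - #{a ∈ F | Odd (c a)} = ∑ a ∈ F, (-1) ^ c a := by
  rw [card_filter, card_filter]
  push_cast
  rw [← sum_sub_distrib]
  refine sum_congr rfl fun a _ => ?_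
  rcases Nat.even_or_odd (c a) with h | h
  · simp [h, h.neg_one_pow]
  · simp [h, h.neg_one_pow]

theorem natCard_distinct_odd_s7 {n k : ℕ} (hk : k ≤ n) (P : ℕ → Prop) [DecidablePred P] :
    Nat.card {π : k.Partition //
      π.parts.Nodup ∧ (∀ x ∈ π.parts, Odd x) ∧ P (Multiset.card π.parts)} =
    #{T ∈ {T ∈ ({x ∈ Icc 1 n | x % 2 = 1 % 2} : Finset ℕ).powerset | 0 + ∑ x ∈ T, x = k} |
      P #T} := by
  refine natCard_partition_eq_card
    (Q := fun m => m.Nodup ∧ (∀ x ∈ m, Odd x) ∧ P (Multiset.card m)) _ Finset.val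
    Finset.val_injective.injOn fun m => ?_
  constructor
  · rintro ⟨T, hT, rfl⟩
    simp only [mem_filter, mem_powerset, subset_iff, mem_Icc, zero_add] at hT
    obtain ⟨⟨hU, hs⟩, hP⟩ := hT
    refine ⟨fun x hx => (hU hx).1.1, by rw [← hs, sum_val]; simp, T.nodup,
      fun x hx => Nat.odd_iff.2 (hU hx).2, hP⟩
  · rintro ⟨hpos, hsum, hnd, hodd, hP⟩
    refine ⟨⟨m, hnd⟩, ?_, rfl⟩
    simp only [mem_filter, mem_powerset, subset_iff, mem_Icc, zero_add]
    refine ⟨⟨fun x hx => ⟨⟨hpos x hx, ?_⟩, Nat.odd_iff.1 (hodd x hx)⟩, ?_⟩, hP⟩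
    · exact (Multiset.le_sum_of_mem hx).trans (hsum.le.trans hk)
    · rw [← hsum]; simp [Finset.sum]

theorem pdo'_eq_coeff {n k : ℕ} (hk : k ≤ n) : pdo' k = (qPochTwo n 1).coeff k := by
  rw [pdo', natCard_distinct_odd_s7 hk Even, natCard_distinct_odd_s7 hk Odd,
    card_filter_even_sub_card_filter_odd, ← coeff_X_pow_mul_prod_one_sub]
  simp [qPochTwo]

/-- The pairs `(s - 1, T)` encoding the partitions of `n` with smallest part `s`, occurring twice,
and set `T` of remaining parts, distinct and incongruent to `s` modulo 2. -/
def sptdoPairs (n : ℕ) : Finset (Σ _ : ℕ, Finset ℕ) :=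
  (range (n + 1)).sigma fun m =>
    {T ∈ ({x ∈ Icc (m + 2) n | x % 2 = (m + 2) % 2} : Finset ℕ).powerset |
      2 * (m + 1) + ∑ x ∈ T, x = n}

/-- The multiset of parts encoded by an element of `sptdoPairs`. -/
def sptdoParts (a : Σ _ : ℕ, Finset ℕ) : Multiset ℕ :=
  Multiset.replicate 2 (a.1 + 1) + a.2.val

theorem mem_sptdoPairs {n m : ℕ} {T : Finset ℕ} :
    (⟨m, T⟩ : Σ _ : ℕ, Finset ℕ) ∈ sptdoPairs n ↔
      (∀ x ∈ T, m + 2 ≤ x ∧ x % 2 = m % 2) ∧ 2 * (m + 1) + ∑ x ∈ T, x = n := by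
  simp only [sptdoPairs, mem_sigma, mem_range, mem_filter, mem_powerset, subset_iff, mem_Icc]
  constructor
  · rintro ⟨-, h, hs⟩
    exact ⟨fun x hx => ⟨(h hx).1.1, by have := (h hx).2; omega⟩, hs⟩
  · rintro ⟨h, hs⟩
    refine ⟨by omega, fun x hx => ⟨⟨(h x hx).1, ?_⟩, by have := (h x hx).2; omega⟩, hs⟩
    have := single_le_sum (f := fun x : ℕ => x) (fun _ _ => Nat.zero_le _) hx
    omega

theorem mem_sptdoParts {m x : ℕ} {T : Finset ℕ} :
    x ∈ sptdoParts ⟨m, T⟩ ↔ x = m + 1 ∨ x ∈ T := by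
  simp [sptdoParts]

theorem sptdoParts_injOn (n : ℕ) : Set.InjOn sptdoParts (sptdoPairs n) := by
  rintro ⟨m, T⟩ ha ⟨m', T'⟩ hb hab
  have ha := (mem_sptdoPairs.1 (mem_coe.1 ha)).1
  have hb := (mem_sptdoPairs.1 (mem_coe.1 hb)).1
  have hm : m = m' := by
    have h₁ := mem_sptdoParts.1 (hab ▸ mem_sptdoParts.2 (Or.inl rfl) : m + 1 ∈ sptdoParts ⟨m', T'⟩)
    have h₂ := mem_sptdoParts.1 (hab ▸ mem_sptdoParts.2 (Or.inl rfl) : m' + 1 ∈ sptdoParts ⟨m, T⟩)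
    rcases h₁ with h₁ | h₁ <;> rcases h₂ with h₂ | h₂
    · omega
    · omega
    · omega
    · have := (ha _ h₂).1
      have := (hb _ h₁).1
      omega
  subst hm
  simp only [sptdoParts, add_right_inj] at hab
  rw [Finset.val_injective hab]

theorem natCard_sptdo_two (n : ℕ) (P : ℕ → Prop) [DecidablePred P] :
    Nat.card {π : n.Partition // ∃ s ∈ π.parts, (∀ x ∈ π.parts, s ≤ x) ∧
      Multiset.count s π.parts = 2 ∧
      (∀ x ∈ π.parts, x ≠ s → Multiset.count x π.parts = 1 ∧ ¬ x % 2 = s % 2) ∧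
      P (Multiset.card (π.parts.filter fun x => s < x))} =
    #{a ∈ sptdoPairs n | P #a.2} := by
  refine natCard_partition_eq_card (Q := fun m => ∃ s ∈ m, (∀ x ∈ m, s ≤ x) ∧
      Multiset.count s m = 2 ∧
      (∀ x ∈ m, x ≠ s → Multiset.count x m = 1 ∧ ¬ x % 2 = s % 2) ∧
      P (Multiset.card (m.filter fun x => s < x))) _ sptdoParts
    ((sptdoParts_injOn n).mono (coe_subset.2 (filter_subset _ _))) fun p => ?_
  constructor
  · rintro ⟨⟨m, T⟩, ha, rfl⟩
    obtain ⟨ha, hP⟩ := mem_filter.1 ha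
    obtain ⟨hT, hs⟩ := mem_sptdoPairs.1 ha
    have hmT : m + 1 ∉ T := fun h => by have := (hT _ h).1; omega
    refine ⟨fun x hx => ?_, ?_, m + 1, mem_sptdoParts.2 (Or.inl rfl), fun x hx => ?_, ?_,
      fun x hx hne => ?_, ?_⟩
    · rcases mem_sptdoParts.1 hx with rfl | h
      · omega
      · have := (hT _ h).1; omega
    · simp only [sptdoParts, Multiset.sum_add, Multiset.sum_replicate, smul_eq_mul, ← hs]
      rw [sum_val]; simp
    · rcases mem_sptdoParts.1 hx with rfl | h
      · omega
      · have := (hT _ h).1; omega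
    · simp only [sptdoParts, Multiset.count_add, Multiset.count_replicate_self]
      rw [Multiset.count_eq_zero_of_notMem (by simpa using hmT)]
    · have h := (mem_sptdoParts.1 hx).resolve_left hne
      refine ⟨?_, by have := (hT _ h).2; omega⟩
      simp only [sptdoParts, Multiset.count_add, Multiset.count_replicate]
      rw [if_neg (Ne.symm hne), Multiset.count_eq_one_of_mem T.nodup h]
    · have h₁ : (Multiset.replicate 2 (m + 1)).filter (fun x => m + 1 < x) = 0 :=
        Multiset.filter_eq_nil.2 fun x hx => by
          rw [Multiset.eq_of_mem_replicate hx]; omega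
      have h₂ : T.val.filter (fun x => m + 1 < x) = T.val :=
        Multiset.filter_eq_self.2 fun x hx => by have := (hT _ hx).1; omega
      simp only [sptdoParts, Multiset.filter_add]
      rw [h₁, h₂, zero_add]
      exact hP
  · rintro ⟨hpos, hsum, s, hs, hmin, hcount, hrest, hP⟩
    obtain ⟨m, rfl⟩ : ∃ m, s = m + 1 := ⟨s - 1, by have := hpos s hs; omega⟩
    have hnd : (p.filter fun x => m + 1 < x).Nodup := by
      refine Multiset.nodup_iff_count_le_one.2 fun x => ?_
      by_cases hx : x ∈ p.filter fun x => m + 1 < x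
      · obtain ⟨hxp, hlt⟩ := Multiset.mem_filter.1 hx
        exact (Multiset.count_le_of_le x (Multiset.filter_le _ _)).trans
          (hrest x hxp hlt.ne').1.le
      · rw [Multiset.count_eq_zero_of_notMem hx]; omega
    have hp : sptdoParts ⟨m, ⟨_, hnd⟩⟩ = p := by
      have h : p.filter (fun x => ¬ m + 1 < x) = Multiset.replicate 2 (m + 1) := by
        rw [← hcount, ← Multiset.filter_eq']
        refine Multiset.filter_congr fun x hx => ?_
        have := hmin x hx
        omega
      rw [sptdoParts, ← h, add_comm]
      exact Multiset.filter_add_not _ _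
    refine ⟨⟨m, ⟨_, hnd⟩⟩, mem_filter.2 ⟨mem_sptdoPairs.2 ⟨fun x hx => ?_, ?_⟩, hP⟩, hp⟩
    · obtain ⟨hxp, hlt⟩ := Multiset.mem_filter.1 (Finset.mem_def.1 hx)
      have := (hrest x hxp hlt.ne').2
      omega
    · rw [← hsum]
      conv_rhs => rw [← hp]
      simp only [sptdoParts, Multiset.sum_add, Multiset.sum_replicate, smul_eq_mul]
      simp [Finset.sum]

open Polynomial in
theorem sptdo'_two_eq_coeff (n : ℕ) :
    sptdo' 2 n =
      (∑ m ∈ range (n + 1), X ^ (2 * (m + 1)) * qPochTwo n (m + 2)).coeff n := by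
  have h₀ : B0 2 n = #{a ∈ sptdoPairs n | Even #a.2} := natCard_sptdo_two n Even
  have h₁ : B1 2 n = #{a ∈ sptdoPairs n | Odd #a.2} := natCard_sptdo_two n Odd
  rw [sptdo', h₀, h₁, card_filter_even_sub_card_filter_odd, sptdoPairs, sum_sigma,
    finsetSum_coeff]
  exact sum_congr rfl fun m _ => (coeff_X_pow_mul_prod_one_sub _ _ _).symm

end Counting

theorem statement7 (n : ℕ) (hn : 5 ≤ n) :
    sptdo' 2 n = pdo' (n - 4) - pdo' (n - 3) - pdo' (n - 2) := by
  rw [sptdo'_two_eq_coeff, sum_X_pow_mul_qPochTwo, pdo'_eq_coeff (n.sub_le 4),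
    pdo'_eq_coeff (n.sub_le 3), pdo'_eq_coeff (n.sub_le 2)]
  obtain ⟨k, rfl⟩ := Nat.exists_eq_add_of_le' hn
  simp [sub_mul, Polynomial.coeff_X_pow_mul', Polynomial.coeff_X_pow, Polynomial.coeff_ofNat_mul]
end

section
/- For all integers k ≥ 1 and t ≥ k+1, B_0(k+1, 2t) + B_1(k, 2t−1) = B_1(k, 2t−2k−1) + p_{de}(2t−k−1) + p_{do}(2t−2k−1), where B_0 and B_1 are taken to vanish when their second argument is less than their first. -/
/-- Pairs `(s, S)` encoding the partition whose smallest part `s` occurs `k` times and whose larger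
parts form the set `S`, of cardinality `≡ e` modulo 2. -/
def sptPairs (k n e : ℕ) : Set (ℕ × Finset ℕ) :=
  {p | 1 ≤ p.1 ∧ (∀ x ∈ p.2, p.1 < x ∧ x % 2 ≠ p.1 % 2) ∧
    k * p.1 + ∑ x ∈ p.2, x = n ∧ p.2.card % 2 = e}

/-- The variant of `sptPairs k n 1` in which `s - 1` is also allowed as an element of `S`. -/
def extendedPairs (k n : ℕ) : Set (ℕ × Finset ℕ) :=
  {p | 1 ≤ p.1 ∧ (∀ x ∈ p.2, p.1 ≤ x + 1 ∧ x % 2 ≠ p.1 % 2) ∧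
    k * p.1 + ∑ x ∈ p.2, x = n ∧ p.2.card % 2 = 1}

/-- Finite sets of positive integers congruent to `r` modulo 2 with sum `n`. -/
def distinctParts (n r : ℕ) : Set (Finset ℕ) :=
  {S | (∀ x ∈ S, 0 < x ∧ x % 2 = r) ∧ ∑ x ∈ S, x = n}

theorem finite_extendedPairs {k : ℕ} (hk : 1 ≤ k) (n : ℕ) : (extendedPairs k n).Finite := by
  refine ((Finset.range (n + 1) ×ˢ (Finset.range (n + 1)).powerset).finite_toSet).subset ?_
  rintro ⟨s, S⟩ ⟨-, -, h, -⟩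
  simp only [Finset.coe_product, Set.mem_prod, Finset.mem_coe, Finset.mem_range,
    Finset.mem_powerset] at h ⊢
  refine ⟨by have := Nat.le_mul_of_pos_left s hk; omega, fun x hx => ?_⟩
  have := Finset.single_le_sum (f := fun x : ℕ => x) (fun _ _ => Nat.zero_le _) hx
  simp only [Finset.mem_range] at this ⊢
  omega

theorem card_partition_subtype (n : ℕ) (P : Multiset ℕ → Prop) :
    Nat.card {π : n.Partition // P π.parts} =
      {m : Multiset ℕ | (∀ x ∈ m, 0 < x) ∧ m.sum = n ∧ P m}.ncard := by
  rw [← Nat.card_coe_set_eq]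
  exact Nat.card_congr
    { toFun := fun π => ⟨π.1.parts, fun _ hx => π.1.parts_pos hx, π.1.parts_sum, π.2⟩
      invFun := fun m => ⟨⟨m.1, fun hx => m.2.1 _ hx, m.2.2.1⟩, m.2.2.2⟩
      left_inv := fun _ => rfl
      right_inv := fun _ => rfl }

theorem filter_lt_replicate_add (k s : ℕ) (S : Finset ℕ) (h : ∀ x ∈ S, s < x) :
    (Multiset.replicate k s + S.val).filter (fun x => s < x) = S.val := by
  rw [Multiset.filter_add, Multiset.filter_eq_nil.2, zero_add, Multiset.filter_eq_self]
  · exact h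
  · intro a ha
    rw [Multiset.eq_of_mem_replicate ha]
    exact lt_irrefl s

theorem ncard_sptPairs {k : ℕ} (hk : 1 ≤ k) (n e : ℕ) :
    (sptPairs k n e).ncard = {m : Multiset ℕ | (∀ x ∈ m, 0 < x) ∧ m.sum = n ∧
      ∃ s ∈ m, (∀ x ∈ m, s ≤ x) ∧ Multiset.count s m = k ∧
      (∀ x ∈ m, x ≠ s → Multiset.count x m = 1 ∧ ¬ x % 2 = s % 2) ∧
      (Multiset.card (m.filter fun x => s < x)) % 2 = e}.ncard := by
  have hk0 : k ≠ 0 := by omega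
  refine Set.ncard_congr (fun p _ => Multiset.replicate k p.1 + p.2.val) ?_ ?_ ?_
  · rintro ⟨s, S⟩ ⟨hs, hS, hsum, hc⟩
    dsimp only at hs hS hsum hc ⊢
    have hsS : s ∉ S := fun h => lt_irrefl _ (hS s h).1
    refine ⟨?_, ?_, s, ?_, ?_, ?_, ?_, ?_⟩
    · intro x hx
      rcases Multiset.mem_add.1 hx with h | h
      · rw [Multiset.eq_of_mem_replicate h]; exact hs
      · have := (hS x h).1; omega
    · rw [← hsum, Multiset.sum_add, Multiset.sum_replicate, smul_eq_mul, Finset.sum_val]; rfl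
    · exact Multiset.mem_add.2 (.inl (Multiset.mem_replicate.2 ⟨hk0, rfl⟩))
    · intro x hx
      rcases Multiset.mem_add.1 hx with h | h
      · rw [Multiset.eq_of_mem_replicate h]
      · exact (hS x h).1.le
    · rw [Multiset.count_add, Multiset.count_replicate_self, Multiset.count_eq_zero.2 hsS, add_zero]
    · intro x hx hne
      rcases Multiset.mem_add.1 hx with h | h
      · exact absurd (Multiset.eq_of_mem_replicate h) hne
      · refine ⟨?_, (hS x h).2⟩
        rw [Multiset.count_add, Multiset.count_replicate, if_neg (Ne.symm hne), zero_add]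
        exact Multiset.count_eq_one_of_mem S.nodup h
    · rw [filter_lt_replicate_add k s S fun x hx => (hS x hx).1]
      exact hc
  · rintro ⟨s, S⟩ ⟨s', S'⟩ ⟨-, hS, -, -⟩ ⟨-, hS', -, -⟩ h
    dsimp only at hS hS' h
    have hle : ∀ {a b : ℕ} {A B : Finset ℕ}, (∀ x ∈ B, b < x ∧ x % 2 ≠ b % 2) →
        Multiset.replicate k a + A.val = Multiset.replicate k b + B.val → b ≤ a := by
      intro a b A B hB hab
      have ha : a ∈ Multiset.replicate k b + B.val := by
        rw [← hab]
        exact Multiset.mem_add.2 (.inl (Multiset.mem_replicate.2 ⟨hk0, rfl⟩))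
      rcases Multiset.mem_add.1 ha with h | h
      · exact (Multiset.eq_of_mem_replicate h).ge
      · exact (hB a h).1.le
    obtain rfl : s = s' := le_antisymm (hle hS h.symm) (hle hS' h)
    exact Prod.ext rfl (Finset.val_injective (add_left_cancel h))
  · rintro m ⟨hpos, hsum, s, hs, hmin, hcount, hrest, hc⟩
    have hnd : (m.filter fun x => s < x).Nodup := by
      rw [Multiset.nodup_iff_count_le_one]
      intro a
      by_cases ha : a ∈ m ∧ s < a
      · rw [Multiset.count_filter_of_pos ha.2]
        exact (hrest a ha.1 ha.2.ne').1.le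
      · rw [Multiset.count_eq_zero.2 (by rwa [Multiset.mem_filter])]
        exact zero_le_one
    have hm : Multiset.replicate k s + m.filter (fun x => s < x) = m := by
      conv_rhs => rw [← Multiset.filter_add_not (fun x => s < x) m]
      rw [add_comm, ← hcount, ← Multiset.filter_eq']
      congr 1
      refine Multiset.filter_congr fun x hx => ?_
      have := hmin x hx
      omega
    refine ⟨(s, ⟨m.filter fun x => s < x, hnd⟩), ⟨hpos s hs, ?_, ?_, hc⟩, hm⟩
    · intro x hx
      obtain ⟨h1, h2⟩ := Multiset.mem_filter.1 (Finset.mem_mk.1 hx)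
      exact ⟨h2, (hrest x h1 h2.ne').2⟩
    · have := congrArg Multiset.sum hm
      rw [Multiset.sum_add, Multiset.sum_replicate, smul_eq_mul, hsum] at this
      simpa [Finset.sum] using this

theorem B0_eq_ncard {k : ℕ} (hk : 1 ≤ k) (n : ℕ) : B0 k n = (sptPairs k n 0).ncard := by
  rw [ncard_sptPairs hk, ← card_partition_subtype]
  simp only [B0, IsSptDOEven, Nat.even_iff]

theorem B1_eq_ncard {k : ℕ} (hk : 1 ≤ k) (n : ℕ) : B1 k n = (sptPairs k n 1).ncard := by
  rw [ncard_sptPairs hk, ← card_partition_subtype]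
  simp only [B1, IsSptDOOdd, Nat.odd_iff]

theorem ncard_distinctParts (n r : ℕ) :
    (distinctParts n r).ncard =
      Nat.card {π : n.Partition // π.parts.Nodup ∧ ∀ x ∈ π.parts, x % 2 = r} := by
  rw [card_partition_subtype n fun m => m.Nodup ∧ ∀ x ∈ m, x % 2 = r]
  refine Set.ncard_congr (fun S _ => S.val) ?_ ?_ ?_
  · rintro S ⟨hS, hsum⟩
    exact ⟨fun x hx => (hS x hx).1, (Finset.sum_val S).trans hsum, S.nodup,
      fun x hx => (hS x hx).2⟩
  · exact fun _ _ _ _ h => Finset.val_injective h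
  · rintro m ⟨hpos, hsum, hnd, hr⟩
    exact ⟨⟨m, hnd⟩, ⟨fun x hx => ⟨hpos x hx, hr x hx⟩, (Finset.sum_val ⟨m, hnd⟩).symm.trans hsum⟩, rfl⟩

theorem pde_eq_ncard (n : ℕ) : pde n = (distinctParts n 0).ncard := by
  simp only [ncard_distinctParts, pde, Nat.even_iff]

theorem pdo_eq_ncard (n : ℕ) : pdo n = (distinctParts n 1).ncard := by
  simp only [ncard_distinctParts, pdo, Nat.odd_iff]

/-- Splitting the extended pairs according to whether `s - 1 ∈ S`. -/
theorem ncard_extendedPairs_eq_B {k : ℕ} (hk : 1 ≤ k) (n : ℕ) :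
    (extendedPairs k n).ncard = B0 (k + 1) (n + 1) + B1 k n := by
  have hfin := finite_extendedPairs hk n
  rw [B0_eq_ncard (by omega), B1_eq_ncard hk, add_comm,
    ← Set.ncard_inter_add_ncard_sdiff_eq_ncard _ {p : ℕ × Finset ℕ | p.1 - 1 ∉ p.2} hfin]
  congr 1
  · congr 1
    ext ⟨s, S⟩
    constructor
    · rintro ⟨⟨hs, hS, hsum, hc⟩, hn⟩
      refine ⟨hs, fun x hx => ⟨?_, (hS x hx).2⟩, hsum, hc⟩
      obtain ⟨h1, h2⟩ := hS x hx
      have : x ≠ s - 1 := fun h => hn (h ▸ hx)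
      dsimp only at *
      have : x ≠ s := fun h => h2 (by rw [h])
      omega
    · rintro ⟨hs, hS, hsum, hc⟩
      refine ⟨⟨hs, fun x hx => ⟨?_, (hS x hx).2⟩, hsum, hc⟩, fun h => ?_⟩
      · have := (hS x hx).1
        omega
      · have := (hS _ h).1
        omega
  · refine Set.ncard_congr (fun p _ => (p.1, p.2.erase (p.1 - 1))) ?_ ?_ ?_
    · rintro ⟨s, S⟩ ⟨⟨hs, hS, hsum, hc⟩, hn⟩
      simp only [Set.mem_ofPred_eq, not_not] at hs hS hsum hc hn
      have h1 := Finset.add_sum_erase S (fun x => x) hn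
      have h2 := Finset.card_erase_add_one hn
      refine ⟨hs, fun x hx => ?_, ?_, ?_⟩
      · obtain ⟨hne, hx⟩ := Finset.mem_erase.1 hx
        obtain ⟨h3, h4⟩ := hS x hx
        dsimp only at *
        have : x ≠ s := fun h => h4 (by rw [h])
        omega
      · dsimp only at *
        rw [add_mul]
        omega
      · dsimp only
        omega
    · rintro ⟨s, S⟩ ⟨s', S'⟩ ⟨-, hn⟩ ⟨-, hn'⟩ h
      simp only [Set.mem_ofPred_eq, not_not, Prod.mk.injEq] at hn hn' h
      obtain ⟨rfl, h⟩ := h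
      rw [← Finset.insert_erase hn, h, Finset.insert_erase hn']
    · rintro ⟨s, S⟩ ⟨hs, hS, hsum, hc⟩
      dsimp only at hs hS hsum hc
      have hn : s - 1 ∉ S := fun h => by
        have := (hS _ h).1
        omega
      refine ⟨(s, insert (s - 1) S), ⟨⟨hs, fun x hx => ?_, ?_, ?_⟩, ?_⟩, ?_⟩
      · rcases Finset.mem_insert.1 hx with rfl | hx
        · dsimp only; omega
        · obtain ⟨h1, h2⟩ := hS x hx
          exact ⟨by dsimp only; omega, h2⟩
      · dsimp only
        rw [Finset.sum_insert hn]
        rw [add_mul] at hsum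
        omega
      · dsimp only
        rw [Finset.card_insert_of_notMem hn]
        omega
      · simp
      · simp [Finset.erase_insert hn]

theorem ncard_extendedPairs_one (k n : ℕ) :
    (extendedPairs k (n + k) ∩ {p | p.1 = 1}).ncard = pde n := by
  rw [pde_eq_ncard]
  refine Set.ncard_congr (fun p _ => p.2.erase 0) ?_ ?_ ?_
  · rintro ⟨s, S⟩ ⟨⟨-, hS, hsum, -⟩, rfl : s = 1⟩
    dsimp only at hS hsum
    refine ⟨fun x hx => ?_, ?_⟩
    · obtain ⟨h0, hx⟩ := Finset.mem_erase.1 hx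
      have := (hS x hx).2
      omega
    · rw [Finset.sum_erase S rfl]
      omega
  · rintro ⟨s, S⟩ ⟨s', S'⟩ ⟨⟨-, -, -, hc⟩, rfl : s = 1⟩ ⟨⟨-, -, -, hc'⟩, rfl : s' = 1⟩ h
    dsimp only at hc hc' h
    by_cases h0 : 0 ∈ S <;> by_cases h0' : 0 ∈ S'
    · rw [← Finset.insert_erase h0, h, Finset.insert_erase h0']
    · have h1 := Finset.card_erase_add_one h0
      rw [h, Finset.erase_eq_of_notMem h0'] at h1
      omega
    · have h1 := Finset.card_erase_add_one h0'
      rw [← h, Finset.erase_eq_of_notMem h0] at h1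
      omega
    · rw [Finset.erase_eq_of_notMem h0, Finset.erase_eq_of_notMem h0'] at h
      rw [h]
  · rintro T ⟨hT, hsum⟩
    have h0 : 0 ∉ T := fun h => lt_irrefl _ (hT 0 h).1
    rcases Nat.mod_two_eq_zero_or_one T.card with hc | hc
    · refine ⟨(1, insert 0 T), ⟨⟨le_rfl, fun x hx => ?_, ?_, ?_⟩, rfl⟩, ?_⟩
      · rcases Finset.mem_insert.1 hx with rfl | hx
        · simp
        · have := (hT x hx).2
          dsimp only; omega
      · dsimp only
        rw [Finset.sum_insert h0]
        omega
      · dsimp only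
        rw [Finset.card_insert_of_notMem h0]
        omega
      · exact Finset.erase_insert h0
    · refine ⟨(1, T), ⟨⟨le_rfl, fun x hx => ?_, ?_, hc⟩, rfl⟩, Finset.erase_eq_of_notMem h0⟩
      · have := (hT x hx).2
        dsimp only; omega
      · dsimp only
        omega

theorem ncard_extendedPairs_two (k : ℕ) {n : ℕ} (hn : n % 2 = 1) :
    (extendedPairs k (n + 2 * k) ∩ {p | p.1 = 2}).ncard = pdo n := by
  rw [pdo_eq_ncard]
  refine Set.ncard_congr (fun p _ => p.2) ?_ ?_ ?_
  · rintro ⟨s, S⟩ ⟨⟨-, hS, hsum, -⟩, rfl : s = 2⟩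
    dsimp only at hS hsum
    refine ⟨fun x hx => ?_, by dsimp only; omega⟩
    have := (hS x hx).2
    omega
  · rintro ⟨s, S⟩ ⟨s', S'⟩ ⟨-, rfl : s = 2⟩ ⟨-, rfl : s' = 2⟩ h
    exact Prod.ext rfl h
  · rintro T ⟨hT, hsum⟩
    refine ⟨(2, T), ⟨⟨by simp, fun x hx => ?_, by dsimp only; omega, ?_⟩, rfl⟩, rfl⟩
    · have := (hT x hx)
      dsimp only; omega
    · have h1 : (∑ x ∈ T, x) % 2 = (∑ _x ∈ T, 1) % 2 := by
        rw [Finset.sum_nat_mod, Finset.sum_congr rfl fun x hx => (hT x hx).2]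
      rw [hsum, hn, Finset.sum_const, smul_eq_mul, mul_one] at h1
      exact h1.symm

theorem ncard_extendedPairs_three {k : ℕ} (hk : 1 ≤ k) (n : ℕ) :
    (extendedPairs k (n + 2 * k) ∩ {p | 3 ≤ p.1}).ncard = B1 k n := by
  rw [B1_eq_ncard hk]
  symm
  refine Set.ncard_congr (fun p _ => (p.1 + 2, p.2)) ?_ ?_ ?_
  · rintro ⟨s, S⟩ ⟨hs, hS, hsum, hc⟩
    dsimp only at hs hS hsum hc
    refine ⟨⟨by dsimp only; omega, fun x hx => ?_, ?_, hc⟩, ?_⟩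
    · have := hS x hx
      dsimp only; omega
    · dsimp only
      rw [mul_add]
      omega
    · simp only [Set.mem_ofPred_eq]
      omega
  · rintro ⟨s, S⟩ ⟨s', S'⟩ - - h
    simpa using h
  · rintro ⟨s, S⟩ ⟨⟨-, hS, hsum, hc⟩, hs : 3 ≤ s⟩
    obtain ⟨s, rfl⟩ : ∃ r, s = r + 2 := ⟨s - 2, by omega⟩
    dsimp only at hS hsum hc
    refine ⟨(s, S), ⟨by dsimp only; omega, fun x hx => ?_, ?_, hc⟩, rfl⟩
    · have := hS x hx
      dsimp only; omega
    · dsimp only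
      rw [mul_add] at hsum
      omega

/-- Splitting the extended pairs according to whether `s = 1`, `s = 2` or `s ≥ 3`. -/
theorem ncard_extendedPairs_eq_sum {k : ℕ} (hk : 1 ≤ k) {n : ℕ} (hn : n % 2 = 1) :
    (extendedPairs k (n + 2 * k)).ncard = B1 k n + pde (n + k) + pdo n := by
  have hfin := finite_extendedPairs hk (n + 2 * k)
  rw [← ncard_extendedPairs_one k, ← ncard_extendedPairs_two k hn, ← ncard_extendedPairs_three hk,
    show n + k + k = n + 2 * k by ring,
    ← Set.ncard_union_eq _ (hfin.inter_of_left _) (hfin.inter_of_left _),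
    ← Set.ncard_union_eq _ ((hfin.inter_of_left _).union (hfin.inter_of_left _))
      (hfin.inter_of_left _), ← Set.inter_union_distrib_left, ← Set.inter_union_distrib_left]
  · congr 1
    refine (Set.inter_eq_left.2 fun p hp => ?_).symm
    have := hp.1
    simp only [Set.mem_union, Set.mem_ofPred_eq]
    omega
  · rw [Set.disjoint_left]
    rintro p (⟨-, h⟩ | ⟨-, h⟩) ⟨-, h'⟩ <;> simp only [Set.mem_ofPred_eq] at h h' <;> omega
  · rw [Set.disjoint_left]
    rintro p ⟨-, h⟩ ⟨-, h'⟩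
    simp only [Set.mem_ofPred_eq] at h h'
    omega

theorem statement11 (k t : ℕ) (hk : 1 ≤ k) (ht : k + 1 ≤ t) :
    B0 (k + 1) (2 * t) + B1 k (2 * t - 1) =
      B1 k (2 * t - 2 * k - 1) + pde (2 * t - k - 1) + pdo (2 * t - 2 * k - 1) := by
  have h1 := ncard_extendedPairs_eq_B hk (2 * t - 1)
  have h2 := ncard_extendedPairs_eq_sum hk (n := 2 * t - 2 * k - 1) (by omega)
  rw [show 2 * t - 1 + 1 = 2 * t by omega] at h1
  rw [show 2 * t - 2 * k - 1 + 2 * k = 2 * t - 1 by omega,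
    show 2 * t - 2 * k - 1 + k = 2 * t - k - 1 by omega] at h2
  exact h1.symm.trans h2
end

section
/- For every integer t ≥ 1, the following four identities hold: B_0(1, 2t+1) = p_{de}(2t); B_0(1, 2t) = p_{de}(2t−1) + p_{do}(2t−1); B_1(1, 2t) = p_{de}(2t−1); and B_1(1, 2t+1) = p_{de}(2t) + p_{do}(2t). -/
/-- Pairs `(s, O)` with `s < x` for all `x ∈ O`, where `s` and the elements of `O` are all
congruent to `p` modulo 2, the total is `N`, and `O` has cardinality `r` modulo 2. -/
def pointedSets (N r p : ℕ) : Set (ℕ × Finset ℕ) :=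
  {a | a.1 % 2 = p ∧ (∀ x ∈ a.2, a.1 < x ∧ x % 2 = p) ∧ a.1 + ∑ x ∈ a.2, x = N ∧
    a.2.card % 2 = r}

theorem pointedSets_finite (N r p : ℕ) : (pointedSets N r p).Finite := by
  refine ((Finset.range (N + 1)) ×ˢ (Finset.range (N + 1)).powerset).finite_toSet.subset ?_
  rintro ⟨s, O⟩ ⟨-, -, hsum, -⟩
  simp only [Finset.coe_product, Set.mem_prod, Finset.mem_coe, Finset.mem_range,
    Finset.mem_powerset] at hsum ⊢
  refine ⟨by omega, fun x hx => ?_⟩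
  have := Finset.single_le_sum (f := fun x : ℕ => x) (fun _ _ => Nat.zero_le _) hx
  simp only [Finset.mem_range] at this ⊢
  omega

theorem card_partition_eq_ncard {α : Type*} {n : ℕ} {P : n.Partition → Prop} {S : Set α}
    (f : α → Multiset ℕ) (hinj : Set.InjOn f S) (hpos : ∀ a ∈ S, ∀ x ∈ f a, 0 < x)
    (hsum : ∀ a ∈ S, (f a).sum = n) (hP : ∀ π : n.Partition, P π ↔ ∃ a ∈ S, f a = π.parts) :
    Nat.card {π : n.Partition // P π} = S.ncard := by
  rw [← Nat.card_coe_set_eq]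
  symm
  let g : S → {π : n.Partition // P π} := fun a =>
    ⟨⟨f a, fun {x} hx => hpos a a.2 x hx, hsum a a.2⟩, (hP _).2 ⟨a, a.2, rfl⟩⟩
  refine Nat.card_congr (Equiv.ofBijective g ⟨fun a b hab => ?_, fun ⟨π, hπ⟩ => ?_⟩)
  · exact Subtype.ext (hinj a.2 b.2 (congrArg (fun π => π.1.parts) hab))
  · obtain ⟨a, ha, h⟩ := (hP π).1 hπ
    exact ⟨⟨a, ha⟩, Subtype.ext (Nat.Partition.ext h)⟩

theorem exists_smallest_iff_exists_cons (m : Multiset ℕ) (Q : ℕ → Prop) :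
    (∃ s ∈ m, (∀ x ∈ m, s ≤ x) ∧ Multiset.count s m = 1 ∧
      (∀ x ∈ m, x ≠ s → Multiset.count x m = 1 ∧ ¬ x % 2 = s % 2) ∧
      Q (Multiset.card (m.filter fun x => s < x))) ↔
    ∃ (s : ℕ) (O : Finset ℕ), s ::ₘ O.val = m ∧ (∀ x ∈ O, s < x ∧ ¬ x % 2 = s % 2) ∧
      Q O.card := by
  constructor
  · rintro ⟨s, hs, hmin, hcount, hrest, hQ⟩
    have hnd : m.Nodup := Multiset.nodup_iff_count_eq_one.2 fun x hx => by
      by_cases h : x = s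
      · rw [h, hcount]
      · exact (hrest x hx h).1
    have herase : m.filter (fun x => s < x) = m.erase s := by
      refine (Multiset.Nodup.ext (hnd.filter _) (hnd.erase s)).2 fun x => ?_
      rw [Multiset.mem_filter, hnd.mem_erase_iff]
      constructor
      · rintro ⟨hx, h⟩
        exact ⟨h.ne', hx⟩
      · rintro ⟨h, hx⟩
        exact ⟨hx, lt_of_le_of_ne (hmin x hx) (Ne.symm h)⟩
    rw [herase] at hQ
    refine ⟨s, ⟨m.erase s, hnd.erase s⟩, Multiset.cons_erase hs, fun x hx => ?_, hQ⟩
    have hx' : x ≠ s ∧ x ∈ m := hnd.mem_erase_iff.1 hx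
    exact ⟨lt_of_le_of_ne (hmin x hx'.2) (Ne.symm hx'.1), (hrest x hx'.2 hx'.1).2⟩
  · rintro ⟨s, O, rfl, hO, hQ⟩
    have hsO : s ∉ O.val := fun h => lt_irrefl _ (hO s h).1
    have hnd : (s ::ₘ O.val).Nodup := Multiset.nodup_cons.2 ⟨hsO, O.nodup⟩
    refine ⟨s, Multiset.mem_cons_self s _, fun x hx => ?_,
      Multiset.count_eq_one_of_mem hnd (Multiset.mem_cons_self s _), fun x hx hne => ?_, ?_⟩
    · rcases Multiset.mem_cons.1 hx with rfl | h
      · exact le_rfl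
      · exact (hO x h).1.le
    · exact ⟨Multiset.count_eq_one_of_mem hnd hx,
        (hO x ((Multiset.mem_cons.1 hx).resolve_left hne)).2⟩
    · rw [Multiset.filter_cons_of_neg _ (lt_irrefl s),
        Multiset.filter_eq_self.2 fun x hx => (hO x hx).1]
      exact hQ

theorem cons_val_inj {s s' : ℕ} {O O' : Finset ℕ} (h : ∀ x ∈ O, s < x) (h' : ∀ x ∈ O', s' < x)
    (heq : s ::ₘ O.val = s' ::ₘ O'.val) : s = s' ∧ O = O' := by
  have h1 : s ∈ s' ::ₘ O'.val := heq ▸ Multiset.mem_cons_self s _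
  have h2 : s' ∈ s ::ₘ O.val := heq ▸ Multiset.mem_cons_self s' _
  have hs : s = s' := by
    rcases Multiset.mem_cons.1 h1 with h1 | h1
    · exact h1
    · rcases Multiset.mem_cons.1 h2 with h2 | h2
      · exact h2.symm
      · exact absurd (h' s h1) (h s' h2).asymm
  subst hs
  exact ⟨rfl, Finset.val_injective ((Multiset.cons_inj_right s).1 heq)⟩

theorem card_smallest_once_eq (N r : ℕ) {P : (N + 1).Partition → Prop}
    (hP : ∀ π, P π ↔ ∃ (s : ℕ) (O : Finset ℕ), s ::ₘ O.val = π.parts ∧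
      (∀ x ∈ O, s < x ∧ ¬ x % 2 = s % 2) ∧ O.card % 2 = r) :
    Nat.card {π // P π} = (pointedSets N r 0).ncard + (pointedSets N r 1).ncard := by
  have hdisj : Disjoint (pointedSets N r 0) (pointedSets N r 1) :=
    Set.disjoint_left.2 fun a h h' => by
      have h0 := h.1
      have h1 := h'.1
      omega
  rw [← Set.ncard_union_eq hdisj (pointedSets_finite N r 0) (pointedSets_finite N r 1)]
  have hmem : ∀ a : ℕ × Finset ℕ, a ∈ pointedSets N r 0 ∪ pointedSets N r 1 ↔
      (∀ x ∈ a.2, a.1 < x ∧ x % 2 = a.1 % 2) ∧ a.1 + ∑ x ∈ a.2, x = N ∧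
        a.2.card % 2 = r := by
    intro a
    constructor
    · rintro (⟨h, h'⟩ | ⟨h, h'⟩) <;> rwa [h]
    · intro h
      rcases Nat.mod_two_eq_zero_or_one a.1 with h' | h' <;> rw [h'] at h
      · exact Or.inl ⟨h', h⟩
      · exact Or.inr ⟨h', h⟩
  have hlt : ∀ a ∈ pointedSets N r 0 ∪ pointedSets N r 1, ∀ x ∈ a.2, a.1 + 1 < x := by
    intro a ha x hx
    have := ((hmem a).1 ha).1 x hx
    omega
  refine card_partition_eq_ncard (fun a => (a.1 + 1) ::ₘ a.2.val) ?_ ?_ ?_ fun π => ?_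
  · rintro ⟨s, O⟩ ha ⟨s', O'⟩ ha' heq
    obtain ⟨h1, h2⟩ := cons_val_inj (hlt _ ha) (hlt _ ha') heq
    exact Prod.ext (Nat.succ_injective h1) h2
  · intro a ha x hx
    rcases Multiset.mem_cons.1 hx with rfl | h
    · exact Nat.succ_pos _
    · exact (Nat.zero_le _).trans_lt (hlt a ha x h)
  · intro a ha
    have h := ((hmem a).1 ha).2.1
    rw [Multiset.sum_cons, Finset.sum_val]
    simp only [id] at h ⊢
    omega
  · rw [hP]
    constructor
    · rintro ⟨s, O, hm, hO, hr⟩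
      have hs : 0 < s := π.parts_pos (hm ▸ Multiset.mem_cons_self s _)
      have hsum := π.parts_sum
      rw [← hm, Multiset.sum_cons, Finset.sum_val] at hsum
      refine ⟨(s - 1, O), (hmem _).2 ⟨fun x hx => ?_, ?_, hr⟩, ?_⟩
      · have := hO x hx
        dsimp only
        omega
      · simp only [id] at hsum ⊢
        omega
      · rw [← hm]
        dsimp only
        rw [Nat.sub_add_cancel hs]
    · rintro ⟨a, ha, hm⟩
      refine ⟨a.1 + 1, a.2, hm, fun x hx => ⟨hlt a ha x hx, ?_⟩, ((hmem a).1 ha).2.2⟩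
      have := (((hmem a).1 ha).1 x hx).2
      omega

theorem B0_one_succ (N : ℕ) :
    B0 1 (N + 1) = (pointedSets N 0 0).ncard + (pointedSets N 0 1).ncard :=
  card_smallest_once_eq N 0 fun π => by
    simp only [← Nat.even_iff (n := Finset.card _)]
    exact exists_smallest_iff_exists_cons π.parts Even

theorem B1_one_succ (N : ℕ) :
    B1 1 (N + 1) = (pointedSets N 1 0).ncard + (pointedSets N 1 1).ncard :=
  card_smallest_once_eq N 1 fun π => by
    simp only [← Nat.odd_iff (n := Finset.card _)]
    exact exists_smallest_iff_exists_cons π.parts Odd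

theorem exists_cons_val_of_ne_nil {m : Multiset ℕ} (hnd : m.Nodup) (hm : m ≠ 0) :
    ∃ (s : ℕ) (O : Finset ℕ), s ::ₘ O.val = m ∧ ∀ x ∈ O, s < x := by
  have hne : (⟨m, hnd⟩ : Finset ℕ).Nonempty := by
    rw [Finset.nonempty_iff_ne_empty]
    exact fun h => hm (congrArg Finset.val h)
  refine ⟨Finset.min' _ hne, (⟨m, hnd⟩ : Finset ℕ).erase (Finset.min' _ hne), ?_, fun x hx => ?_⟩
  · rw [Finset.erase_val]
    exact Multiset.cons_erase (Finset.min'_mem _ hne)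
  · exact Finset.min'_lt_of_mem_erase_min' _ hne hx

theorem pde_eq_ncard_s14 {N r : ℕ} (hN : 0 < N) (hr : r < 2) :
    pde N = (pointedSets N r 0).ncard := by
  refine card_partition_eq_ncard
    (fun a => if a.1 = 0 then a.2.val else a.1 ::ₘ a.2.val) ?_ ?_ ?_ fun π => ?_
  · rintro ⟨s, O⟩ ⟨-, hO, -, hc⟩ ⟨s', O'⟩ ⟨-, hO', -, hc'⟩ heq
    have hcard := congrArg Multiset.card heq
    dsimp only at *
    split_ifs at heq hcard with h h' h'
    · rw [h, h', Finset.val_injective heq]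
    · simp only [Multiset.card_cons, Finset.card_val] at hcard
      omega
    · simp only [Multiset.card_cons, Finset.card_val] at hcard
      omega
    · obtain ⟨h1, h2⟩ := cons_val_inj (fun x hx => (hO x hx).1) (fun x hx => (hO' x hx).1) heq
      rw [h1, h2]
  · rintro ⟨s, O⟩ ⟨-, hO, -, -⟩ x hx
    dsimp only at *
    split_ifs at hx with h
    · exact (Nat.zero_le _).trans_lt (hO x hx).1
    · rcases Multiset.mem_cons.1 hx with rfl | hx
      · exact Nat.pos_of_ne_zero h
      · exact (Nat.zero_le _).trans_lt (hO x hx).1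
  · rintro ⟨s, O⟩ ⟨-, -, hsum, -⟩
    dsimp only at *
    split_ifs with h
    · rw [Finset.sum_val]
      simpa [h] using hsum
    · rw [Multiset.sum_cons, Finset.sum_val]
      exact hsum
  · constructor
    · rintro ⟨hnd, heven⟩
      have hsum := π.parts_sum
      have hpos : ∀ x ∈ π.parts, 0 < x := fun x hx => π.parts_pos hx
      by_cases hc : Multiset.card π.parts % 2 = r
      · refine ⟨(0, ⟨π.parts, hnd⟩), ⟨rfl, fun x hx => ⟨hpos x hx, ?_⟩, ?_, hc⟩, if_pos rfl⟩
        · exact Nat.even_iff.1 (heven x hx)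
        · rw [zero_add]
          exact (Finset.sum_val _).symm.trans hsum
      · have hne : π.parts ≠ 0 := by
          intro h
          rw [h, Multiset.sum_zero] at hsum
          omega
        obtain ⟨s, O, hm, hO⟩ := exists_cons_val_of_ne_nil hnd hne
        rw [← hm] at hsum hpos heven hc
        rw [Multiset.sum_cons, Finset.sum_val] at hsum
        rw [Multiset.card_cons, Finset.card_val] at hc
        refine ⟨(s, O), ⟨Nat.even_iff.1 (heven s (Multiset.mem_cons_self s _)),
          fun x hx => ⟨hO x hx, Nat.even_iff.1 (heven x (Multiset.mem_cons_of_mem hx))⟩,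
          hsum, ?_⟩, ?_⟩
        · dsimp only
          omega
        · rw [← hm]
          exact if_neg (hpos s (Multiset.mem_cons_self s _)).ne'
    · rintro ⟨⟨s, O⟩, ⟨hs, hO, -, -⟩, hm⟩
      dsimp only at *
      rw [← hm]
      have hsO : s ∉ O.val := fun h => lt_irrefl _ (hO s h).1
      split_ifs
      · exact ⟨O.nodup, fun x hx => Nat.even_iff.2 (hO x hx).2⟩
      · refine ⟨Multiset.nodup_cons.2 ⟨hsO, O.nodup⟩, fun x hx => ?_⟩
        rcases Multiset.mem_cons.1 hx with rfl | hx
        · exact Nat.even_iff.2 hs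
        · exact Nat.even_iff.2 (hO x hx).2

theorem sum_mod_two_of_forall_odd {O : Finset ℕ} (hO : ∀ x ∈ O, x % 2 = 1) :
    (∑ x ∈ O, x) % 2 = O.card % 2 := by
  rw [Finset.sum_nat_mod, Finset.sum_congr rfl hO, Finset.sum_const, smul_eq_mul, mul_one]

theorem pointedSets_one_eq_empty {N r : ℕ} (h : N % 2 = r) : pointedSets N r 1 = ∅ := by
  rw [Set.eq_empty_iff_forall_notMem]
  rintro ⟨s, O⟩ ⟨hs, hO, hsum, hc⟩
  have := sum_mod_two_of_forall_odd fun x hx => (hO x hx).2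
  dsimp only at *
  omega

theorem pdo_eq_ncard_s14 {N r : ℕ} (hN : 0 < N) (hr : r < 2) (h : N % 2 ≠ r) :
    pdo N = (pointedSets N r 1).ncard := by
  refine card_partition_eq_ncard (fun a => a.1 ::ₘ a.2.val) ?_ ?_ ?_ fun π => ?_
  · rintro ⟨s, O⟩ ⟨-, hO, -, -⟩ ⟨s', O'⟩ ⟨-, hO', -, -⟩ heq
    obtain ⟨h1, h2⟩ := cons_val_inj (fun x hx => (hO x hx).1) (fun x hx => (hO' x hx).1) heq
    exact Prod.ext h1 h2
  · rintro ⟨s, O⟩ ⟨hs, hO, -, -⟩ x hx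
    rcases Multiset.mem_cons.1 hx with rfl | hx
    · dsimp only at *
      omega
    · exact (Nat.zero_le _).trans_lt (hO x hx).1
  · rintro ⟨s, O⟩ ⟨-, -, hsum, -⟩
    rw [Multiset.sum_cons, Finset.sum_val]
    exact hsum
  · constructor
    · rintro ⟨hnd, hodd⟩
      have hsum := π.parts_sum
      have hne : π.parts ≠ 0 := by
        intro h
        rw [h, Multiset.sum_zero] at hsum
        omega
      obtain ⟨s, O, hm, hO⟩ := exists_cons_val_of_ne_nil hnd hne
      rw [← hm, Multiset.sum_cons, Finset.sum_val] at hsum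
      rw [← hm] at hodd
      have hs : s % 2 = 1 := Nat.odd_iff.1 (hodd s (Multiset.mem_cons_self s _))
      have hO' : ∀ x ∈ O, x % 2 = 1 := fun x hx =>
        Nat.odd_iff.1 (hodd x (Multiset.mem_cons_of_mem hx))
      refine ⟨(s, O), ⟨hs, fun x hx => ⟨hO x hx, hO' x hx⟩, hsum, ?_⟩, hm⟩
      have := sum_mod_two_of_forall_odd hO'
      simp only [id] at hsum ⊢
      omega
    · rintro ⟨⟨s, O⟩, ⟨hs, hO, -, -⟩, hm⟩
      rw [← hm]
      have hsO : s ∉ O.val := fun h => lt_irrefl _ (hO s h).1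
      refine ⟨Multiset.nodup_cons.2 ⟨hsO, O.nodup⟩, fun x hx => ?_⟩
      rcases Multiset.mem_cons.1 hx with rfl | hx
      · exact Nat.odd_iff.2 hs
      · exact Nat.odd_iff.2 (hO x hx).2

theorem statement14 (t : ℕ) (ht : 1 ≤ t) :
    B0 1 (2 * t + 1) = pde (2 * t) ∧
    B0 1 (2 * t) = pde (2 * t - 1) + pdo (2 * t - 1) ∧
    B1 1 (2 * t) = pde (2 * t - 1) ∧
    B1 1 (2 * t + 1) = pde (2 * t) + pdo (2 * t) := by
  obtain ⟨M, hM⟩ : ∃ M, 2 * t = M + 1 := ⟨2 * t - 1, by omega⟩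
  have hpos : 0 < 2 * t := by omega
  have hM0 : 0 < M := by omega
  refine ⟨?_, ?_, ?_, ?_⟩
  · rw [B0_one_succ, pointedSets_one_eq_empty (by omega), Set.ncard_empty, add_zero,
      pde_eq_ncard_s14 hpos two_pos]
  · rw [hM, Nat.add_sub_cancel, B0_one_succ, pde_eq_ncard_s14 hM0 two_pos,
      pdo_eq_ncard_s14 hM0 two_pos (by omega)]
  · rw [hM, Nat.add_sub_cancel, B1_one_succ, pointedSets_one_eq_empty (by omega),
      Set.ncard_empty, add_zero, pde_eq_ncard_s14 hM0 one_lt_two]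
  · rw [B1_one_succ, pde_eq_ncard_s14 hpos one_lt_two, pdo_eq_ncard_s14 hpos one_lt_two (by omega)]
end
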